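/- arXiv:2010.10114 — 6 statements merged into one kernel-verified Lean document; each statement's English description precedes it below -/
import Mathlib

section
/- For every algebraically closed field K and every integer n ≥ 1, the ring R_n = K[u,v,x,y]/(uv − xy(xⁿ+y)) is a normal integral domain: the principal ideal generated by f_n = uv − xy(xⁿ+y) is a prime ideal of K[u,v,x,y], and the quotient ring R_n is an integral domain which is integrally closed in its field of fractions. -/
open MvPolynomial

/-- The polynomial `f_n = u·v − x·y·(xⁿ + y)` in `K[u,v,x,y]`, where the variables
`u, v, x, y` are `X 0, X 1, X 2, X 3`. -/
noncomputable def doubleBubblePoly (K : Type*) [Field K] (n : ℕ) : MvPolynomial (Fin 4) K :=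
  X 0 * X 1 - X 2 * X 3 * ((X 2) ^ n + X 3)

/-- If `R[1/u]` and `R[1/v]` are integrally closed and `v` is a nonzerodivisor modulo `u`, then
`R = R[1/u] ∩ R[1/v]` is integrally closed. -/
theorem IsIntegrallyClosed.of_localizationAway_pair {R : Type*} [CommRing R] [IsDomain R] {u v : R}
    (hu : u ≠ 0) (hv : v ≠ 0) (huv : ∀ a, u ∣ a * v → u ∣ a)
    (hRu : IsIntegrallyClosed (Localization.Away u))
    (hRv : IsIntegrallyClosed (Localization.Away v)) : IsIntegrallyClosed R := by
  have huv_pow : ∀ m a, u ∣ a * v ^ m → u ∣ a := by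
    intro m
    induction m with
    | zero => intro a h; simpa using h
    | succ m ih => intro a h; exact ih a (huv _ (by rwa [mul_assoc, ← pow_succ]))
  have hpow_dvd : ∀ n m a, u ^ n ∣ a * v ^ m → u ^ n ∣ a := by
    intro n m
    induction n with
    | zero => intro a _; simp
    | succ n ih =>
      intro a h
      obtain ⟨b, rfl⟩ := huv_pow m a ((dvd_pow_self u n.succ_ne_zero).trans h)
      rw [pow_succ', mul_assoc] at h
      rw [pow_succ']
      exact mul_dvd_mul_left u (ih b ((mul_dvd_mul_iff_left hu).mp h))
  have hS : ∀ b : Bool, Submonoid.powers (bif b then u else v) ≤ nonZeroDivisors R := by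
    intro b
    apply powers_le_nonZeroDivisors_of_noZeroDivisors
    cases b <;> assumption
  refine IsIntegrallyClosed.of_localization_submonoid
    (fun b : Bool => Submonoid.powers (bif b then u else v)) hS
    (by rintro (_ | _) <;> assumption) ?_
  rw [eq_bot_iff]
  intro z hz
  rw [Algebra.mem_iInf] at hz
  obtain ⟨a, _, ⟨n, rfl⟩, ha⟩ := hz true
  obtain ⟨b, _, ⟨m, rfl⟩, hb⟩ := hz false
  rw [IsFractionRing.mk'_eq_div] at ha hb
  have hinj := IsFractionRing.injective R (FractionRing R)
  have hu' : algebraMap R (FractionRing R) u ≠ 0 := by simpa using hu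
  have hv' : algebraMap R (FractionRing R) v ≠ 0 := by simpa using hv
  have hab : a * v ^ m = b * u ^ n := by
    apply hinj
    rw [ha] at hb
    simp only [cond_true, cond_false, map_pow, map_mul] at hb ⊢
    field_simp at hb
    linear_combination hb
  obtain ⟨c, rfl⟩ := hpow_dvd n m a ⟨b, by rw [hab, mul_comm]⟩
  refine Algebra.mem_bot.mpr ⟨c, ?_⟩
  rw [ha]
  simp only [cond_true, map_pow, map_mul]
  field_simp

theorem IsIntegrallyClosed.localizationAway_of_ringEquiv {R S : Type*} [CommRing R] [CommRing S]
    (e : R ≃+* S) {r : R} {s : S} (hrs : e r = s) (h : IsIntegrallyClosed (Localization.Away s)) :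
    IsIntegrallyClosed (Localization.Away r) := by
  have H : (Submonoid.powers r).map e.toMonoidHom = Submonoid.powers s := by
    rw [Submonoid.map_powers]
    exact congrArg _ hrs
  exact h.of_equiv (IsLocalization.ringEquivOfRingEquiv (M := Submonoid.powers r)
    (T := Submonoid.powers s) (Localization.Away r) (Localization.Away s) e H).symm

namespace Polynomial

section Linear

variable {B : Type*} [CommRing B] {u g : B}

theorem exists_pow_mul_sub_C_mem_span (u g : B) (p : B[X]) :
    ∃ (n : ℕ) (c : B), C u ^ n * p - C c ∈ Ideal.span {C u * X - C g} := by
  simp only [Ideal.mem_span_singleton]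
  induction p using Polynomial.induction_on' with
  | add p q hp hq =>
    obtain ⟨n, c, r, hr⟩ := hp
    obtain ⟨m, d, s, hs⟩ := hq
    refine ⟨n + m, u ^ m * c + u ^ n * d, C u ^ m * r + C u ^ n * s, ?_⟩
    simp only [C_add, C_mul, C_pow]
    linear_combination C u ^ m * hr + C u ^ n * hs
  | monomial k b =>
    refine ⟨k, b * g ^ k, ?_⟩
    rw [← C_mul_X_pow_eq_monomial, C_mul, C_pow,
      show C u ^ k * (C b * X ^ k) - C b * C g ^ k = C b * ((C u * X) ^ k - C g ^ k) by ring]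
    exact (sub_dvd_pow_sub_pow _ _ k).mul_left _

/-- The evaluation map `B[X] → B[1/u]` sending `X` to `g / u`. -/
noncomputable def evalFraction (u g : B) : B[X] →+* Localization.Away u :=
  eval₂RingHom (algebraMap B _) (algebraMap B _ g * IsLocalization.Away.invSelf u)

theorem evalFraction_C (u g b : B) : evalFraction u g (C b) = algebraMap B _ b := by
  simp [evalFraction]

theorem evalFraction_linear (u g : B) : evalFraction u g (C u * X - C g) = 0 := by
  simp only [evalFraction, coe_eval₂RingHom, eval₂_sub, eval₂_mul, eval₂_C, eval₂_X]
  linear_combination algebraMap B (Localization.Away u) g *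
    IsLocalization.Away.mul_invSelf (S := Localization.Away u) u

variable [IsDomain B]

theorem linear_dvd_of_dvd_C_mul (hu : Prime u) (hg : ¬ u ∣ g) {p : B[X]}
    (h : C u * X - C g ∣ C u * p) : C u * X - C g ∣ p := by
  obtain ⟨q, hq⟩ := h
  rcases (prime_C_iff.mpr hu).dvd_or_dvd (Dvd.intro _ hq) with h | ⟨r, rfl⟩
  · refine absurd ?_ hg
    have := (dvd_sub_right (dvd_mul_right (C u) X)).mp h
    simpa using (C_dvd_iff_dvd_coeff _ _).mp this 0
  · refine ⟨r, mul_left_cancel₀ (C_ne_zero.mpr hu.ne_zero) ?_⟩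
    rw [hq]
    ring

theorem ker_evalFraction (hu : Prime u) (hg : ¬ u ∣ g) :
    RingHom.ker (evalFraction u g) = Ideal.span {C u * X - C g} := by
  refine le_antisymm (fun p hp => ?_) ?_
  · obtain ⟨n, c, h⟩ := exists_pow_mul_sub_C_mem_span u g p
    rw [Ideal.mem_span_singleton] at h ⊢
    have hc : c = 0 := by
      obtain ⟨q, hq⟩ := h
      have := congrArg (evalFraction u g) hq
      rw [map_sub, map_mul, map_mul, evalFraction_linear, RingHom.mem_ker.mp hp, evalFraction_C,
        mul_zero, zero_mul, zero_sub, neg_eq_zero] at this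
      exact (IsLocalization.to_map_eq_zero_iff (Localization.Away u)
        (powers_le_nonZeroDivisors_of_noZeroDivisors hu.ne_zero)).mp this
    rw [hc, C_0, sub_zero] at h
    clear hc hp
    induction n with
    | zero => simpa using h
    | succ n ih =>
      rw [pow_succ', mul_assoc] at h
      exact ih (linear_dvd_of_dvd_C_mul hu hg h)
  · rw [Ideal.span_singleton_le_iff_mem]
    exact evalFraction_linear u g

theorem isPrime_span_linear (hu : Prime u) (hg : ¬ u ∣ g) :
    (Ideal.span {C u * X - C g}).IsPrime := by
  have : IsDomain (Localization.Away u) := Localization.Away.isDomain hu.ne_zero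
  rw [← ker_evalFraction hu hg]
  exact RingHom.ker_isPrime _

theorem isIntegrallyClosed_localizationAway_quotient_linear [IsIntegrallyClosed B]
    (hu : Prime u) (hg : ¬ u ∣ g) :
    IsIntegrallyClosed (Localization.Away
      (Ideal.Quotient.mk (Ideal.span {C u * X - C g}) (C u))) := by
  have hker := ker_evalFraction hu hg
  let φ : B[X] ⧸ Ideal.span {C u * X - C g} →+* Localization.Away u :=
    Ideal.Quotient.lift _ (evalFraction u g) fun a ha => by rwa [← hker] at ha
  have hφ : Function.Injective φ :=
    RingHom.lift_injective_of_ker_le_ideal _ _ hker.le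
  have hφC (b : B) : φ (Ideal.Quotient.mk _ (C b)) = algebraMap B _ b := evalFraction_C u g b
  let : Algebra (B[X] ⧸ Ideal.span {C u * X - C g}) (Localization.Away u) := φ.toAlgebra
  have : IsLocalization.Away (Ideal.Quotient.mk (Ideal.span {C u * X - C g}) (C u))
      (Localization.Away u) := by
    refine IsLocalization.Away.mk _ ?_ (fun s => ?_) fun a b h => ⟨0, by rw [hφ h]⟩
    · rw [RingHom.algebraMap_toAlgebra, hφC]
      exact IsLocalization.Away.algebraMap_isUnit u
    · obtain ⟨n, a, h⟩ := IsLocalization.Away.surj u s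
      refine ⟨n, Ideal.Quotient.mk _ (C a), ?_⟩
      rw [RingHom.algebraMap_toAlgebra, hφC, hφC, h]
  have hL : IsIntegrallyClosed (Localization.Away u) :=
    isIntegrallyClosed_of_isLocalization _ (Submonoid.powers u)
      (powers_le_nonZeroDivisors_of_noZeroDivisors hu.ne_zero)
  exact hL.of_equiv (IsLocalization.algEquiv (Submonoid.powers
    (Ideal.Quotient.mk (Ideal.span {C u * X - C g}) (C u))) (Localization.Away u) _).toRingEquiv

theorem mk_C_dvd_of_dvd_mul_mk_X (hu : Prime u) (hg : ¬ u ∣ g)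
    (a : B[X] ⧸ Ideal.span {C u * X - C g})
    (h : Ideal.Quotient.mk _ (C u) ∣ a * Ideal.Quotient.mk _ X) :
    Ideal.Quotient.mk _ (C u) ∣ a := by
  obtain ⟨a, rfl⟩ := Ideal.Quotient.mk_surjective a
  obtain ⟨p, hp⟩ := h
  obtain ⟨p, rfl⟩ := Ideal.Quotient.mk_surjective p
  rw [← map_mul, ← map_mul, Ideal.Quotient.mk_eq_mk_iff_sub_mem, Ideal.mem_span_singleton] at hp
  obtain ⟨q, hq⟩ := hp
  have hq0 : u ∣ q.coeff 0 := by
    have h0 := congrArg (eval 0) hq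
    simp only [eval_sub, eval_mul, eval_C, eval_X, ← coeff_zero_eq_eval_zero, mul_zero,
      zero_sub] at h0
    refine (hu.dvd_or_dvd (?_ : u ∣ g * q.coeff 0)).resolve_left hg
    exact ⟨p.coeff 0, by linear_combination h0⟩
  obtain ⟨r, hr⟩ := hq0
  have hqX := divX_mul_X_add q
  rw [hr, C_mul] at hqX
  set s := p + (C u * X - C g) * C r with hs
  have hXs : (X : B[X]) ∣ s := by
    refine (prime_X.dvd_or_dvd (?_ : X ∣ C u * s)).resolve_left fun h => hu.ne_zero ?_
    · exact ⟨a - (C u * X - C g) * q.divX, by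
        rw [hs]; linear_combination -hq + (C u * X - C g) * hqX⟩
    · simpa using X_dvd_iff.mp h
  obtain ⟨t, ht⟩ := hXs
  refine ⟨Ideal.Quotient.mk _ t, ?_⟩
  rw [← map_mul, Ideal.Quotient.mk_eq_mk_iff_sub_mem, Ideal.mem_span_singleton]
  refine ⟨q.divX, mul_right_cancel₀ X_ne_zero ?_⟩
  linear_combination hq + C u * (ht - hs) - (C u * X - C g) * hqX

end Linear

end Polynomial

section Hypersurface

variable (K : Type*) [Field K] (n : ℕ)

theorem not_X_zero_dvd {n : ℕ} (hn : 1 ≤ n) :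
    ¬ (X 0 : MvPolynomial (Fin 3) K) ∣ X 1 * X 2 * (X 1 ^ n + X 2) := by
  intro h
  rcases X_prime.dvd_or_dvd h with h | h
  · rcases X_prime.dvd_or_dvd h with h | h <;> simp [X_dvd_X] at h
  · have := map_dvd (MvPolynomial.eval (![0, 0, 1] : Fin 3 → K)) h
    simp [zero_pow (by omega : n ≠ 0)] at this

theorem finSuccEquiv_doubleBubblePoly :
    finSuccEquiv K 3 (doubleBubblePoly K n) =
      Polynomial.C (X 0) * Polynomial.X - Polynomial.C (X 1 * X 2 * (X 1 ^ n + X 2)) := by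
  have h1 : finSuccEquiv K 3 (X 1) = Polynomial.C (X 0) := finSuccEquiv_X_succ (j := (0 : Fin 3))
  have h2 : finSuccEquiv K 3 (X 2) = Polynomial.C (X 1) := finSuccEquiv_X_succ (j := (1 : Fin 3))
  have h3 : finSuccEquiv K 3 (X 3) = Polynomial.C (X 2) := finSuccEquiv_X_succ (j := (2 : Fin 3))
  simp only [doubleBubblePoly, map_sub, map_mul, map_add, map_pow, finSuccEquiv_X_zero, h1, h2, h3]
  ring

theorem rename_swap_doubleBubblePoly :
    renameEquiv K (Equiv.swap (0 : Fin 4) 1) (doubleBubblePoly K n) = doubleBubblePoly K n := by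
  have h2 : Equiv.swap (0 : Fin 4) 1 2 = 2 := by decide
  have h3 : Equiv.swap (0 : Fin 4) 1 3 = 3 := by decide
  simp only [doubleBubblePoly, renameEquiv_apply, map_sub, map_mul, map_add, map_pow, rename_X,
    Equiv.swap_apply_left, Equiv.swap_apply_right, h2, h3]
  ring

end Hypersurface

/-- For every algebraically closed field `K` and every `n ≥ 1`, the ring
`R_n = K[u,v,x,y]/(uv − xy(xⁿ+y))` is a normal integral domain: the principal ideal
generated by `f_n` is prime, the quotient is a domain, and the quotient is integrally
closed in its field of fractions. -/
theorem Rn_is_normal_domain (K : Type*) [Field K] [IsAlgClosed K] (n : ℕ) (hn : 1 ≤ n) :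
    (Ideal.span {doubleBubblePoly K n}).IsPrime ∧
    IsDomain (MvPolynomial (Fin 4) K ⧸ Ideal.span {doubleBubblePoly K n}) ∧
    IsIntegrallyClosed (MvPolynomial (Fin 4) K ⧸ Ideal.span {doubleBubblePoly K n}) := by
  set f := doubleBubblePoly K n
  set u : MvPolynomial (Fin 3) K := X 0
  set g : MvPolynomial (Fin 3) K := X 1 * X 2 * (X 1 ^ n + X 2)
  have hu : Prime u := X_prime
  have hg : ¬ u ∣ g := not_X_zero_dvd K hn
  let J := Ideal.span {Polynomial.C u * Polynomial.X - Polynomial.C g}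
  have hJ : J.IsPrime := Polynomial.isPrime_span_linear hu hg
  let e₁ : (MvPolynomial (Fin 4) K ⧸ Ideal.span {f}) ≃+*
      (Polynomial (MvPolynomial (Fin 3) K) ⧸ J) :=
    Ideal.quotientEquiv _ _ (finSuccEquiv K 3).toRingEquiv (by
      rw [Ideal.map_span, Set.image_singleton]
      exact congrArg (fun p => Ideal.span {p}) (finSuccEquiv_doubleBubblePoly K n).symm)
  let σ : (MvPolynomial (Fin 4) K ⧸ Ideal.span {f}) ≃+*
      (MvPolynomial (Fin 4) K ⧸ Ideal.span {f}) :=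
    Ideal.quotientEquiv _ _ (renameEquiv K (Equiv.swap (0 : Fin 4) 1)).toRingEquiv (by
      rw [Ideal.map_span, Set.image_singleton]
      exact congrArg (fun p => Ideal.span {p}) (rename_swap_doubleBubblePoly K n).symm)
  have hdom : IsDomain (MvPolynomial (Fin 4) K ⧸ Ideal.span {f}) := e₁.toMulEquiv.isDomain _
  have he₀ : e₁ (Ideal.Quotient.mk _ (X 0)) = Ideal.Quotient.mk J Polynomial.X :=
    congrArg (Ideal.Quotient.mk J) finSuccEquiv_X_zero
  have he₁ : e₁ (Ideal.Quotient.mk _ (X 1)) = Ideal.Quotient.mk J (Polynomial.C u) :=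
    congrArg (Ideal.Quotient.mk J) (finSuccEquiv_X_succ (j := (0 : Fin 3)))
  have hσ₀ : σ (Ideal.Quotient.mk _ (X 0)) = Ideal.Quotient.mk _ (X 1) :=
    congrArg (Ideal.Quotient.mk _) (by simp)
  have hloc := Polynomial.isIntegrallyClosed_localizationAway_quotient_linear hu hg
  have hloc₁ := IsIntegrallyClosed.localizationAway_of_ringEquiv e₁ he₁ hloc
  have hloc₀ := IsIntegrallyClosed.localizationAway_of_ringEquiv σ hσ₀ hloc₁
  have hu0 : Ideal.Quotient.mk (Ideal.span {f}) (X 1) ≠ 0 := by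
    intro h
    rw [h, map_zero, eq_comm, Ideal.Quotient.eq_zero_iff_mem] at he₁
    rw [show J = _ from (Polynomial.ker_evalFraction hu hg).symm, RingHom.mem_ker,
      Polynomial.evalFraction_C] at he₁
    exact hu.ne_zero ((IsLocalization.to_map_eq_zero_iff (Localization.Away u)
      (powers_le_nonZeroDivisors_of_noZeroDivisors hu.ne_zero)).mp he₁)
  have hv0 : Ideal.Quotient.mk (Ideal.span {f}) (X 0) ≠ 0 := by
    intro h
    rw [h, map_zero] at hσ₀
    exact hu0 hσ₀.symm
  refine ⟨(Ideal.Quotient.isDomain_iff_prime _).mp hdom, hdom,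
    IsIntegrallyClosed.of_localizationAway_pair hu0 hv0 (fun a ha => ?_) hloc₁ hloc₀⟩
  have := map_dvd e₁ ha
  rw [map_mul, he₀, he₁] at this
  have := Polynomial.mk_C_dvd_of_dvd_mul_mk_X hu hg _ this
  rwa [← he₁, map_dvd_iff] at this
end

section
/- For every algebraically closed field K, the ring R_0 = K[u,v,x,y]/(uv − xy²) is a normal integral domain: the principal ideal generated by f_0 = uv − xy² is a prime ideal of K[u,v,x,y], and the quotient ring R_0 is an integral domain which is integrally closed in its field of fractions. -/
open MvPolynomial

/-- The polynomial `f_0 = u·v − x·y²` in `K[u,v,x,y]`, where the variables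
`u, v, x, y` are `X 0, X 1, X 2, X 3`. -/
noncomputable def suspendedPinchPointPoly (K : Type*) [Field K] : MvPolynomial (Fin 4) K :=
  X 0 * X 1 - X 2 * X 3 ^ 2

/-- A ring `R` that is a retract, as an `R`-module, of an integrally closed domain `A` is
integrally closed. Additivity of the retraction is not needed. -/
theorem isIntegrallyClosed_of_retraction {R A : Type*} [CommRing R] [CommRing A] [IsDomain R]
    [IsDomain A] [IsIntegrallyClosed A] (φ : R →+* A) (hφ : Function.Injective φ) (r : A → R)
    (hr : ∀ a b, r (φ a * b) = a * r b) (hone : r 1 = 1) : IsIntegrallyClosed R := by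
  have hrφ (a : R) : r (φ a) = a := by simpa [hone] using hr a 1
  let Φ : FractionRing R →+* FractionRing A := IsFractionRing.map hφ
  have hΦ (a : R) : Φ (algebraMap R _ a) = algebraMap A _ (φ a) := IsLocalization.map_eq _ a
  rw [isIntegrallyClosed_iff (FractionRing R)]
  intro z hz
  obtain ⟨f, g, hg, rfl⟩ := IsFractionRing.div_surjective (A := R) z
  have hg0 : g ≠ 0 := nonZeroDivisors.ne_zero hg
  have hint : IsIntegral A (Φ (algebraMap R _ f / algebraMap R _ g)) :=
    hz.map_of_comp_eq φ Φ (RingHom.ext fun a => (hΦ a).symm)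
  obtain ⟨h, hh⟩ := IsIntegrallyClosed.isIntegral_iff.mp hint
  have hφg : algebraMap A (FractionRing A) (φ g) ≠ 0 := by
    simpa using (map_ne_zero_iff φ hφ).mpr hg0
  rw [map_div₀, hΦ, hΦ, eq_div_iff hφg, ← map_mul] at hh
  have hfg : φ g * h = φ f := by
    rw [mul_comm]; exact IsFractionRing.injective A (FractionRing A) hh
  refine ⟨r h, ?_⟩
  rw [eq_div_iff (by simpa using hg0), ← map_mul, mul_comm, ← hr, hfg, hrφ]

/-- The monomial parametrization `u = a b²`, `v = c d²`, `x = a c`, `y = b d` of the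
hypersurface `u v = x y²`. -/
noncomputable def suspendedPinchPointParam (K : Type*) [Field K] :
    MvPolynomial (Fin 4) K →ₐ[K] MvPolynomial (Fin 4) K :=
  aeval ![X 0 * X 1 ^ 2, X 2 * X 3 ^ 2, X 0 * X 2, X 1 * X 3]

theorem suspendedPinchPointParam_X (K : Type*) [Field K] (i : Fin 4) :
    suspendedPinchPointParam K (X i) = monomial
      (![Finsupp.single 0 1 + Finsupp.single 1 2, Finsupp.single 2 1 + Finsupp.single 3 2,
        Finsupp.single 0 1 + Finsupp.single 2 1, Finsupp.single 1 1 + Finsupp.single 3 1] i) 1 := by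
  rw [suspendedPinchPointParam, aeval_X]
  fin_cases i <;> simp [X, monomial_pow, monomial_mul]

/-- The parametrization as a map from the coordinate ring of the hypersurface. -/
noncomputable def suspendedPinchPointLift (K : Type*) [Field K] :
    MvPolynomial (Fin 4) K ⧸ Ideal.span {suspendedPinchPointPoly K} →+* MvPolynomial (Fin 4) K :=
  Ideal.Quotient.lift _ (suspendedPinchPointParam K : _ →+* _) fun a ha => by
    obtain ⟨b, rfl⟩ := Ideal.mem_span_singleton'.mp ha
    simp only [suspendedPinchPointPoly, suspendedPinchPointParam, RingHom.coe_coe, map_mul,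
      map_sub, map_pow, aeval_X, Matrix.cons_val]
    ring

/-- For weights `(2, -1, -2, 1)` of `a, b, c, d`, sends a monomial `aⁱ bʲ cᵏ dˡ` of weight zero to
the monomial in `u, v, x, y` parametrized by it, and the others to zero. -/
noncomputable def monomialSection {R : Type*} [CommRing R] (u v x y : R) (m : Fin 4 →₀ ℕ) : R :=
  if 2 * m 0 + m 3 = m 1 + 2 * m 2 then
    u ^ (m 0 - m 2) * v ^ (m 2 - m 0) * x ^ min (m 0) (m 2) * y ^ min (m 1) (m 3)
  else 0

section monomialSection

variable {R : Type*} [CommRing R] {u v x y : R} (m n : Fin 4 →₀ ℕ)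

theorem monomialSection_u (h : u * v = x * y ^ 2) (h0 : n 0 = m 0 + 1) (h1 : n 1 = m 1 + 2)
    (h2 : n 2 = m 2) (h3 : n 3 = m 3) :
    monomialSection u v x y n = u * monomialSection u v x y m := by
  unfold monomialSection
  rw [h0, h1, h2, h3]
  generalize m 0 = i, m 1 = j, m 2 = k, m 3 = l
  by_cases hw : 2 * i + l = j + 2 * k
  · rw [if_pos (by omega), if_pos hw]
    rcases le_or_gt k i with hki | hki
    · obtain ⟨t, rfl⟩ := Nat.exists_eq_add_of_le hki
      obtain rfl : j = l + 2 * t := by omega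
      rw [show k + t + 1 - k = t + 1 by omega, show k - (k + t + 1) = 0 by omega,
        show k + t - k = t by omega, show k - (k + t) = 0 by omega,
        min_eq_right (by omega), min_eq_right (by omega), min_eq_right (by omega),
        min_eq_right (by omega)]
      ring
    · obtain ⟨t, rfl⟩ := Nat.exists_eq_add_of_lt hki
      obtain rfl : l = j + 2 * (t + 1) := by omega
      rw [show i + 1 - (i + t + 1) = 0 by omega, show i + t + 1 - (i + 1) = t by omega,
        show i - (i + t + 1) = 0 by omega, show i + t + 1 - i = t + 1 by omega,
        min_eq_left (by omega), min_eq_left (by omega), min_eq_left (by omega),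
        min_eq_left (by omega)]
      linear_combination (-(v ^ t * x ^ i * y ^ j)) * h
  · rw [if_neg (by omega), if_neg hw, mul_zero]

theorem monomialSection_swap (h0 : n 0 = m 2) (h1 : n 1 = m 3) (h2 : n 2 = m 0)
    (h3 : n 3 = m 1) : monomialSection v u x y n = monomialSection u v x y m := by
  unfold monomialSection
  rw [h0, h1, h2, h3, min_comm (m 2), min_comm (m 3), mul_comm (v ^ _)]
  exact if_congr (by omega) rfl rfl

theorem monomialSection_v (h : u * v = x * y ^ 2) (h0 : n 0 = m 0) (h1 : n 1 = m 1)
    (h2 : n 2 = m 2 + 1) (h3 : n 3 = m 3 + 2) :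
    monomialSection u v x y n = v * monomialSection u v x y m := by
  let s (w : Fin 4 →₀ ℕ) : Fin 4 →₀ ℕ := Finsupp.equivFunOnFinite.symm ![w 2, w 3, w 0, w 1]
  rw [← monomialSection_swap n (s n) rfl rfl rfl rfl,
    ← monomialSection_swap m (s m) rfl rfl rfl rfl]
  exact monomialSection_u _ _ (by rw [mul_comm, h]) h2 h3 h0 h1

theorem monomialSection_x (h0 : n 0 = m 0 + 1) (h1 : n 1 = m 1)
    (h2 : n 2 = m 2 + 1) (h3 : n 3 = m 3) :
    monomialSection u v x y n = x * monomialSection u v x y m := by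
  unfold monomialSection
  rw [h0, h1, h2, h3, Nat.add_sub_add_right, Nat.add_sub_add_right, min_add_add_right, mul_ite,
    mul_zero]
  exact if_congr (by omega) (by ring) rfl

theorem monomialSection_y (h0 : n 0 = m 0) (h1 : n 1 = m 1 + 1)
    (h2 : n 2 = m 2) (h3 : n 3 = m 3 + 1) :
    monomialSection u v x y n = y * monomialSection u v x y m := by
  unfold monomialSection
  rw [h0, h1, h2, h3, min_add_add_right, mul_ite, mul_zero]
  exact if_congr (by omega) (by ring) rfl

end monomialSection

/-- The linear retraction of the parametrization, given by `monomialSection` on monomials. -/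
noncomputable def suspendedPinchPointRetraction (K : Type*) [Field K] :
    MvPolynomial (Fin 4) K →ₗ[K]
      MvPolynomial (Fin 4) K ⧸ Ideal.span {suspendedPinchPointPoly K} :=
  (basisMonomials (Fin 4) K).constr K fun m =>
    monomialSection (Ideal.Quotient.mk _ (X 0)) (Ideal.Quotient.mk _ (X 1))
      (Ideal.Quotient.mk _ (X 2)) (Ideal.Quotient.mk _ (X 3)) m

theorem suspendedPinchPointRetraction_monomial (K : Type*) [Field K] (m : Fin 4 →₀ ℕ) :
    suspendedPinchPointRetraction K (monomial m 1) =
      monomialSection (Ideal.Quotient.mk _ (X 0)) (Ideal.Quotient.mk _ (X 1))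
        (Ideal.Quotient.mk _ (X 2)) (Ideal.Quotient.mk _ (X 3)) m := by
  have h : monomial m (1 : K) = basisMonomials (Fin 4) K m := by rw [coe_basisMonomials]
  rw [h]
  exact Module.Basis.constr_basis _ _ _ _

theorem suspendedPinchPointRetraction_one (K : Type*) [Field K] :
    suspendedPinchPointRetraction K 1 = 1 := by
  rw [← C_1, C_apply, suspendedPinchPointRetraction_monomial]
  simp [monomialSection]

theorem suspendedPinchPointRetraction_X_mul (K : Type*) [Field K] (i : Fin 4)
    (b : MvPolynomial (Fin 4) K) :
    suspendedPinchPointRetraction K (suspendedPinchPointParam K (X i) * b) =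
      Ideal.Quotient.mk _ (X i) * suspendedPinchPointRetraction K b := by
  have hrel : (Ideal.Quotient.mk (Ideal.span {suspendedPinchPointPoly K})) (X 0) *
      Ideal.Quotient.mk _ (X 1) = Ideal.Quotient.mk _ (X 2) * Ideal.Quotient.mk _ (X 3) ^ 2 := by
    rw [← map_mul, ← map_pow, ← map_mul, Ideal.Quotient.mk_eq_mk_iff_sub_mem]
    exact Ideal.mem_span_singleton_self _
  induction b using MvPolynomial.induction_on' with
  | add p q hp hq => rw [mul_add, map_add, hp, hq, map_add, mul_add]
  | monomial m c =>
    have hc : monomial m c = c • monomial m (1 : K) := by rw [smul_monomial, smul_eq_mul, mul_one]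
    rw [hc, mul_smul_comm, map_smul, map_smul, mul_smul_comm]
    congr 1
    rw [suspendedPinchPointParam_X, monomial_mul, one_mul, suspendedPinchPointRetraction_monomial,
      suspendedPinchPointRetraction_monomial]
    fin_cases i
    · apply monomialSection_u _ _ hrel <;> simp [add_comm]
    · apply monomialSection_v _ _ hrel <;> simp [add_comm]
    · apply monomialSection_x <;> simp [add_comm]
    · apply monomialSection_y <;> simp [add_comm]

theorem suspendedPinchPointRetraction_lift_mul (K : Type*) [Field K]
    (a : MvPolynomial (Fin 4) K ⧸ Ideal.span {suspendedPinchPointPoly K})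
    (b : MvPolynomial (Fin 4) K) :
    suspendedPinchPointRetraction K (suspendedPinchPointLift K a * b) =
      a * suspendedPinchPointRetraction K b := by
  obtain ⟨p, rfl⟩ := Ideal.Quotient.mk_surjective a
  change suspendedPinchPointRetraction K (suspendedPinchPointParam K p * b) = _
  induction p using MvPolynomial.induction_on generalizing b with
  | C c =>
    rw [← algebraMap_eq, AlgHom.commutes, ← Algebra.smul_def, map_smul]
    exact Algebra.smul_def
      (A := MvPolynomial (Fin 4) K ⧸ Ideal.span {suspendedPinchPointPoly K}) c _
  | add p q hp hq => rw [map_add, add_mul, map_add, hp, hq, map_add, add_mul]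
  | mul_X p i hp =>
    rw [map_mul (suspendedPinchPointParam K), mul_assoc, hp, suspendedPinchPointRetraction_X_mul,
      map_mul, mul_assoc]

/-- For every algebraically closed field `K`, the ring `R_0 = K[u,v,x,y]/(uv − xy²)` is a
normal integral domain: the principal ideal generated by `f_0` is prime, the quotient is a
domain, and the quotient is integrally closed in its field of fractions. -/
theorem R0_is_normal_domain (K : Type*) [Field K] [IsAlgClosed K] :
    (Ideal.span {suspendedPinchPointPoly K}).IsPrime ∧
    IsDomain (MvPolynomial (Fin 4) K ⧸ Ideal.span {suspendedPinchPointPoly K}) ∧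
    IsIntegrallyClosed (MvPolynomial (Fin 4) K ⧸ Ideal.span {suspendedPinchPointPoly K}) := by
  have hinj : Function.Injective (suspendedPinchPointLift K) :=
    Function.LeftInverse.injective (g := suspendedPinchPointRetraction K) fun a => by
      simpa [suspendedPinchPointRetraction_one] using
        suspendedPinchPointRetraction_lift_mul K a 1
  have hdom : IsDomain (MvPolynomial (Fin 4) K ⧸ Ideal.span {suspendedPinchPointPoly K}) :=
    hinj.isDomain (suspendedPinchPointLift K)
  exact ⟨(Ideal.Quotient.isDomain_iff_prime _).mp hdom, hdom,
    isIntegrallyClosed_of_retraction (suspendedPinchPointLift K) hinj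
      (suspendedPinchPointRetraction K) (suspendedPinchPointRetraction_lift_mul K)
      (suspendedPinchPointRetraction_one K)⟩
end

section
/- For every prime p and every natural number n, the group cohomology Hⁿ(ℤ/p; 𝔽_p) of the cyclic group of order p with coefficients in the one-dimensional trivial representation on 𝔽_p is a one-dimensional 𝔽_p-vector space. (Equivalently, Ext^n over the group algebra 𝔽_p[ℤ/p] of the trivial module 𝔽_p with itself is one-dimensional for all n, so that H^*(ℤ/p;𝔽_p) ≅ Λ(y) ⊗ 𝔽_p[z] with |y| = 1, |z| = 2 as graded vector spaces.) -/
open CategoryTheory in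
/-- The homology of a short complex with zero differentials has the dimension of its middle
term. -/
lemma CategoryTheory.ShortComplex.finrank_homology_of_zeros {k : Type*} [CommRing k]
    (S : ShortComplex (ModuleCat k)) (hf : S.f = 0) (hg : S.g = 0) :
    Module.finrank k S.homology = Module.finrank k S.X₂ :=
  (HomologyData.ofZeros S hf hg).left.homologyIso.toLinearEquiv.finrank_eq

lemma Multiplicative.zmod_mem_zpowers_ofAdd_one (n : ℕ) (x : Multiplicative (ZMod n)) :
    x ∈ Subgroup.zpowers (Multiplicative.ofAdd (1 : ZMod n)) :=
  ⟨(x.toAdd : ZMod n).cast, by simp [← ofAdd_zsmul]⟩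

open CategoryTheory in
lemma Rep.applyAsHom_trivial_sub_id {k G : Type} [CommRing k] [CommGroup G] (g : G) :
    Rep.applyAsHom (Rep.trivial k G k) g - 𝟙 _ = 0 := by
  ext; simp [Rep.sub_hom, Rep.applyAsHom]

lemma Rep.norm_trivial_eq_zero {k G : Type} [CommRing k] [CommGroup G] [Fintype G]
    (h : (Fintype.card G : k) = 0) : (Rep.trivial k G k).norm = 0 := by
  refine Rep.hom_ext ?_
  ext; simp [Rep.norm, Representation.norm, h]

/-- For every prime `p` and every `n`, the group cohomology `Hⁿ(ℤ/p; 𝔽_p)` of the cyclic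
group of order `p` with coefficients in the trivial one-dimensional representation `𝔽_p` is a
one-dimensional `𝔽_p`-vector space. -/
theorem groupCohomology_zmod_trivial_finrank_eq_one (p : ℕ) [Fact p.Prime] (n : ℕ) :
    Module.finrank (ZMod p)
      (groupCohomology
        (Rep.trivial (ZMod p) (Multiplicative (ZMod p)) (ZMod p)) n) = 1 := by
  have hgen := Multiplicative.zmod_mem_zpowers_ofAdd_one p
  have hsub := Rep.applyAsHom_trivial_sub_id (k := ZMod p) (Multiplicative.ofAdd (1 : ZMod p))
  have hnorm := Rep.norm_trivial_eq_zero (k := ZMod p) (G := Multiplicative (ZMod p)) (by simp)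
  obtain rfl | hn := eq_or_ne n 0
  · exact (groupCohomology.H0IsoOfIsTrivial _).toLinearEquiv.finrank_eq.trans
      (Module.finrank_self _)
  have : NeZero n := ⟨hn⟩
  obtain he | ho := n.even_or_odd
  · rw [(Rep.FiniteCyclicGroup.groupCohomologyIsoEven _ _ hgen n he).toLinearEquiv.finrank_eq,
      CategoryTheory.ShortComplex.finrank_homology_of_zeros]
    · exact Module.finrank_self _
    · simp [hnorm]
    · simp [hsub]
  · rw [(Rep.FiniteCyclicGroup.groupCohomologyIsoOdd _ _ hgen n ho).toLinearEquiv.finrank_eq,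
      CategoryTheory.ShortComplex.finrank_homology_of_zeros]
    · exact Module.finrank_self _
    · simp [hsub]
    · simp [hnorm]
end

section
/- Let K be an algebraically closed field and k = 1, so that a Λ_con-module is a tuple (V₁, V₂, α, β) with α ∘ β ∘ α = 0 and β ∘ α ∘ β = 0. Every nonzero indecomposable finite-dimensional Λ_con-module is isomorphic to exactly one of the following six representations: S₁ = (K, 0, 0, 0); S₂ = (0, K, 0, 0); M₁ = (K, K, id, 0); M₂ = (K, K, 0, id); Q₁ = (K², K, α(s,t) = s, β(t) = (0,t)); Q₂ = (K, K², α(t) = (0,t), β(s,t) = s). -/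
/-- A finite-dimensional module over the contraction algebra `Λ_con` (the path algebra of
the two-cycle quiver with arrows `a : 1 → 2`, `b : 2 → 1` modulo `(ab)^k a = 0` and
`b (ab)^k = 0`), given concretely as a representation `(V₁, V₂, α, β)` with
`α ∘ (β ∘ α)^k = 0` and `(β ∘ α)^k ∘ β = 0`. -/
structure LamRep (K : Type) [Field K] (k : ℕ) : Type 1 where
  V1 : Type
  V2 : Type
  [acg1 : AddCommGroup V1]
  [acg2 : AddCommGroup V2]
  [mod1 : Module K V1]
  [mod2 : Module K V2]
  [fd1 : FiniteDimensional K V1]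
  [fd2 : FiniteDimensional K V2]
  α : V1 →ₗ[K] V2
  β : V2 →ₗ[K] V1
  rel1 : α ∘ₗ ((β ∘ₗ α) ^ k) = 0
  rel2 : ((β ∘ₗ α) ^ k) ∘ₗ β = 0

attribute [instance] LamRep.acg1 LamRep.acg2 LamRep.mod1 LamRep.mod2 LamRep.fd1 LamRep.fd2

namespace LamRep

variable {K : Type} [Field K] {k : ℕ}

/-- A morphism of `Λ_con`-modules is a pair of linear maps commuting with the structure
maps. -/
def IsHom (M N : LamRep K k) (φ1 : M.V1 →ₗ[K] N.V1) (φ2 : M.V2 →ₗ[K] N.V2) : Prop :=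
  φ2 ∘ₗ M.α = N.α ∘ₗ φ1 ∧ φ1 ∘ₗ M.β = N.β ∘ₗ φ2

/-- An isomorphism of `Λ_con`-modules is a pair of linear isomorphisms commuting with the
structure maps. -/
def Iso (M N : LamRep K k) : Prop :=
  ∃ (φ1 : M.V1 ≃ₗ[K] N.V1) (φ2 : M.V2 ≃ₗ[K] N.V2),
    M.IsHom N (φ1 : M.V1 →ₗ[K] N.V1) (φ2 : M.V2 →ₗ[K] N.V2)

/-- The zero representation: both underlying vector spaces are trivial. -/
def IsZero (M : LamRep K k) : Prop := Subsingleton M.V1 ∧ Subsingleton M.V2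

theorem prodMap_pow {V W : Type} [AddCommGroup V] [Module K V] [AddCommGroup W] [Module K W]
    (f : V →ₗ[K] V) (g : W →ₗ[K] W) (n : ℕ) :
    (f.prodMap g) ^ n = (f ^ n).prodMap (g ^ n) := by
  induction n with
  | zero => ext <;> simp
  | succ n ih => rw [pow_succ, pow_succ, pow_succ, ih, LinearMap.prodMap_mul]

/-- The direct sum of two representations, taken componentwise. -/
def dsum (M N : LamRep K k) : LamRep K k where
  V1 := M.V1 × N.V1
  V2 := M.V2 × N.V2
  α := M.α.prodMap N.α
  β := M.β.prodMap N.β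
  rel1 := by
    have h : (M.β.prodMap N.β) ∘ₗ (M.α.prodMap N.α) = (M.β ∘ₗ M.α).prodMap (N.β ∘ₗ N.α) :=
      LinearMap.prodMap_comp _ _ _ _
    rw [h, prodMap_pow,
      show (M.α.prodMap N.α) ∘ₗ (((M.β ∘ₗ M.α) ^ k).prodMap ((N.β ∘ₗ N.α) ^ k)) =
        (M.α ∘ₗ ((M.β ∘ₗ M.α) ^ k)).prodMap (N.α ∘ₗ ((N.β ∘ₗ N.α) ^ k)) from
        LinearMap.prodMap_comp _ _ _ _, M.rel1, N.rel1, LinearMap.prodMap_zero]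
  rel2 := by
    have h : (M.β.prodMap N.β) ∘ₗ (M.α.prodMap N.α) = (M.β ∘ₗ M.α).prodMap (N.β ∘ₗ N.α) :=
      LinearMap.prodMap_comp _ _ _ _
    rw [h, prodMap_pow,
      show (((M.β ∘ₗ M.α) ^ k).prodMap ((N.β ∘ₗ N.α) ^ k)) ∘ₗ (M.β.prodMap N.β) =
        (((M.β ∘ₗ M.α) ^ k) ∘ₗ M.β).prodMap (((N.β ∘ₗ N.α) ^ k) ∘ₗ N.β) from
        LinearMap.prodMap_comp _ _ _ _, M.rel2, N.rel2, LinearMap.prodMap_zero]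

/-- A representation is indecomposable if it is nonzero and not isomorphic to a direct sum
of two nonzero representations. -/
def Indecomposable (M : LamRep K k) : Prop :=
  ¬ M.IsZero ∧ ∀ N P : LamRep K k, M.Iso (N.dsum P) → N.IsZero ∨ P.IsZero

/-- The endomorphism space of a representation, as a `K`-subspace of the product of the two
spaces of linear endomorphisms. -/
def endSpace (M : LamRep K k) :
    Submodule K ((M.V1 →ₗ[K] M.V1) × (M.V2 →ₗ[K] M.V2)) where
  carrier := {φ | M.IsHom M φ.1 φ.2}
  zero_mem' := by
    constructor <;> simp [LinearMap.zero_comp, LinearMap.comp_zero]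
  add_mem' := by
    rintro φ ψ ⟨h1, h2⟩ ⟨h3, h4⟩
    constructor
    · simp only [Prod.fst_add, Prod.snd_add, LinearMap.add_comp, LinearMap.comp_add, h1, h3]
    · simp only [Prod.fst_add, Prod.snd_add, LinearMap.add_comp, LinearMap.comp_add, h2, h4]
  smul_mem' := by
    rintro c φ ⟨h1, h2⟩
    constructor
    · simp only [Prod.smul_fst, Prod.smul_snd, LinearMap.smul_comp, LinearMap.comp_smul, h1]
    · simp only [Prod.smul_fst, Prod.smul_snd, LinearMap.smul_comp, LinearMap.comp_smul, h2]


variable (K)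

/-- The simple module `S₁ = (K, 0, 0, 0)`. -/
def S1 : LamRep K k where
  V1 := K
  V2 := PUnit
  α := 0
  β := 0
  rel1 := by rw [LinearMap.zero_comp]
  rel2 := by rw [LinearMap.comp_zero]

/-- The simple module `S₂ = (0, K, 0, 0)`. -/
def S2 : LamRep K k where
  V1 := PUnit
  V2 := K
  α := 0
  β := 0
  rel1 := by rw [LinearMap.zero_comp]
  rel2 := by rw [LinearMap.comp_zero]

/-- The module `M₁ = (K, K, id, 0)` (a representation whenever `k ≥ 1`). -/
def M1 (hk : 1 ≤ k) : LamRep K k where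
  V1 := K
  V2 := K
  α := LinearMap.id
  β := 0
  rel1 := by
    rw [LinearMap.zero_comp, zero_pow (Nat.one_le_iff_ne_zero.mp hk), LinearMap.comp_zero]
  rel2 := by rw [LinearMap.comp_zero]

/-- The module `M₂ = (K, K, 0, id)` (a representation whenever `k ≥ 1`). -/
def M2 (hk : 1 ≤ k) : LamRep K k where
  V1 := K
  V2 := K
  α := 0
  β := LinearMap.id
  rel1 := by rw [LinearMap.zero_comp]
  rel2 := by
    rw [LinearMap.comp_zero, zero_pow (Nat.one_le_iff_ne_zero.mp hk), LinearMap.zero_comp]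

/-- The projective module `Q₁ = (K², K, α(s,t) = s, β(t) = (0,t))` for `k = 1`. -/
def Q1 : LamRep K 1 where
  V1 := K × K
  V2 := K
  α := LinearMap.fst K K K
  β := LinearMap.inr K K K
  rel1 := by ext <;> simp
  rel2 := by ext <;> simp

/-- The projective module `Q₂ = (K, K², α(t) = (0,t), β(s,t) = s)` for `k = 1`. -/
def Q2 : LamRep K 1 where
  V1 := K
  V2 := K × K
  α := LinearMap.inr K K K
  β := LinearMap.fst K K K
  rel1 := by ext <;> simp
  rel2 := by ext <;> simp

end LamRep

namespace LamRep

variable {K : Type} [Field K] {k : ℕ}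

theorem exists_dual_apply_eq_one {V : Type} [AddCommGroup V] [Module K V] {v : V} (hv : v ≠ 0) :
    ∃ f : V →ₗ[K] K, f v = 1 := by
  obtain ⟨f, hf⟩ : ∃ f : Module.Dual K V, f v ≠ 0 := by
    by_contra! h
    exact hv ((Module.forall_dual_apply_eq_zero_iff K v).mp h)
  exact ⟨(f v)⁻¹ • f, by simp [hf]⟩

/-- The kernel of a morphism of representations. -/
def ker {M N : LamRep K 1} {p1 : M.V1 →ₗ[K] N.V1} {p2 : M.V2 →ₗ[K] N.V2}
    (hp : M.IsHom N p1 p2) : LamRep K 1 where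
  V1 := LinearMap.ker p1
  V2 := LinearMap.ker p2
  α := M.α.restrict (p := LinearMap.ker p1) (q := LinearMap.ker p2) fun x hx => by
    have h := LinearMap.congr_fun hp.1 x
    simp_all
  β := M.β.restrict (p := LinearMap.ker p2) (q := LinearMap.ker p1) fun x hx => by
    have h := LinearMap.congr_fun hp.2 x
    simp_all
  rel1 := by
    ext x
    simpa using LinearMap.congr_fun M.rel1 x.1
  rel2 := by
    ext x
    simpa using LinearMap.congr_fun M.rel2 x.1

/-- The decomposition `V ≃ W × ker p` given by a section `i` of `p`. -/
def splitEquiv {V W : Type} [AddCommGroup V] [Module K V] [AddCommGroup W] [Module K W]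
    (i : W →ₗ[K] V) (p : V →ₗ[K] W) (h : ∀ w, p (i w) = w) : V ≃ₗ[K] W × LinearMap.ker p where
  toFun v := (p v, ⟨v - i (p v), by simp [h]⟩)
  map_add' x y := by ext <;> simp; abel
  map_smul' c x := by ext <;> simp [smul_sub]
  invFun x := i x.1 + x.2
  left_inv v := by simp
  right_inv x := by ext <;> simp [h]

/-- A nonzero retract of an indecomposable representation is isomorphic to it. -/
theorem Indecomposable.iso_of_retract {M : LamRep K 1} (hM : M.Indecomposable)
    {W1 W2 : Type} [AddCommGroup W1] [Module K W1] [FiniteDimensional K W1]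
    [AddCommGroup W2] [Module K W2] [FiniteDimensional K W2]
    (a : W1 →ₗ[K] W2) (b : W2 →ₗ[K] W1)
    (r1 : a ∘ₗ ((b ∘ₗ a) ^ 1) = 0) (r2 : ((b ∘ₗ a) ^ 1) ∘ₗ b = 0)
    (hW : Nontrivial W1 ∨ Nontrivial W2)
    (i1 : W1 →ₗ[K] M.V1) (i2 : W2 →ₗ[K] M.V2) (p1 : M.V1 →ₗ[K] W1) (p2 : M.V2 →ₗ[K] W2)
    (iα : ∀ x, i2 (a x) = M.α (i1 x)) (iβ : ∀ x, i1 (b x) = M.β (i2 x))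
    (pα : ∀ x, p2 (M.α x) = a (p1 x)) (pβ : ∀ x, p1 (M.β x) = b (p2 x))
    (h1 : ∀ x, p1 (i1 x) = x) (h2 : ∀ x, p2 (i2 x) = x) :
    M.Iso { V1 := W1, V2 := W2, α := a, β := b, rel1 := r1, rel2 := r2 } := by
  let N : LamRep K 1 := { V1 := W1, V2 := W2, α := a, β := b, rel1 := r1, rel2 := r2 }
  have hp : M.IsHom N p1 p2 :=
    ⟨LinearMap.ext pα, LinearMap.ext pβ⟩
  have hiso : M.Iso (N.dsum (ker hp)) := by
    refine ⟨splitEquiv i1 p1 h1, splitEquiv i2 p2 h2, ?_, ?_⟩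
    · refine LinearMap.ext fun x => Prod.ext (pα x) (Subtype.ext ?_)
      change M.α x - i2 (p2 (M.α x)) = M.α (x - i1 (p1 x))
      rw [pα, iα, map_sub]
    · refine LinearMap.ext fun x => Prod.ext (pβ x) (Subtype.ext ?_)
      change M.β x - i1 (p1 (M.β x)) = M.β (x - i2 (p2 x))
      rw [pβ, iβ, map_sub]
  obtain ⟨hk1, hk2⟩ := (hM.2 _ _ hiso).resolve_left fun h =>
    hW.elim (fun h' => not_subsingleton_iff_nontrivial.mpr h' h.1)
      (fun h' => not_subsingleton_iff_nontrivial.mpr h' h.2)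
  have b1 : Function.Bijective p1 :=
    ⟨LinearMap.ker_eq_bot.mp ((Submodule.subsingleton_iff_eq_bot).mp hk1), fun x => ⟨_, h1 x⟩⟩
  have b2 : Function.Bijective p2 :=
    ⟨LinearMap.ker_eq_bot.mp ((Submodule.subsingleton_iff_eq_bot).mp hk2), fun x => ⟨_, h2 x⟩⟩
  exact ⟨LinearEquiv.ofBijective p1 b1, LinearEquiv.ofBijective p2 b2, hp⟩

theorem αβα_apply (M : LamRep K 1) (x : M.V1) : M.α (M.β (M.α x)) = 0 := by
  simpa using LinearMap.congr_fun M.rel1 x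

theorem βαβ_apply (M : LamRep K 1) (x : M.V2) : M.β (M.α (M.β x)) = 0 := by
  simpa using LinearMap.congr_fun M.rel2 x

theorem Indecomposable.iso_Q1 {M : LamRep K 1} (hM : M.Indecomposable) {v : M.V1}
    (hv : M.β (M.α v) ≠ 0) : M.Iso (Q1 K) := by
  obtain ⟨f, hf⟩ := exists_dual_apply_eq_one (K := K) hv
  obtain ⟨w, hw, hw0⟩ : ∃ w, f (M.β (M.α w)) = 1 ∧ f w = 0 :=
    ⟨v - f v • M.β (M.α v), by simp [αβα_apply, hf], by simp [hf]⟩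
  refine hM.iso_of_retract (LinearMap.fst K K K) (LinearMap.inr K K K) _ _ (.inl inferInstance)
    (LinearMap.coprod (LinearMap.toSpanSingleton K _ w)
      (LinearMap.toSpanSingleton K _ (M.β (M.α w))))
    (LinearMap.toSpanSingleton K _ (M.α w))
    (LinearMap.prod (f ∘ₗ M.β ∘ₗ M.α) f) (f ∘ₗ M.β) ?_ ?_ ?_ ?_ ?_ ?_ <;>
    simp [αβα_apply, βαβ_apply, hw, hw0]

theorem Indecomposable.iso_Q2 {M : LamRep K 1} (hM : M.Indecomposable) {v : M.V2}
    (hv : M.α (M.β v) ≠ 0) : M.Iso (Q2 K) := by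
  obtain ⟨f, hf⟩ := exists_dual_apply_eq_one (K := K) hv
  obtain ⟨w, hw, hw0⟩ : ∃ w, f (M.α (M.β w)) = 1 ∧ f w = 0 :=
    ⟨v - f v • M.α (M.β v), by simp [βαβ_apply, hf], by simp [hf]⟩
  refine hM.iso_of_retract (LinearMap.inr K K K) (LinearMap.fst K K K) _ _ (.inl inferInstance)
    (LinearMap.toSpanSingleton K _ (M.β w))
    (LinearMap.coprod (LinearMap.toSpanSingleton K _ w)
      (LinearMap.toSpanSingleton K _ (M.α (M.β w))))
    (f ∘ₗ M.α) (LinearMap.prod (f ∘ₗ M.α ∘ₗ M.β) f) ?_ ?_ ?_ ?_ ?_ ?_ <;>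
    simp [αβα_apply, βαβ_apply, hw, hw0]

theorem Indecomposable.iso_M1 {M : LamRep K 1} (hM : M.Indecomposable)
    (hαβ : ∀ x, M.α (M.β x) = 0) (hβα : ∀ x, M.β (M.α x) = 0) {v : M.V1} (hv : M.α v ≠ 0) :
    M.Iso (M1 K le_rfl) := by
  obtain ⟨f, hf⟩ := exists_dual_apply_eq_one (K := K) hv
  refine hM.iso_of_retract LinearMap.id 0 _ _ (.inl inferInstance)
    (LinearMap.toSpanSingleton K _ v) (LinearMap.toSpanSingleton K _ (M.α v))
    (f ∘ₗ M.α) f ?_ ?_ ?_ ?_ ?_ ?_ <;>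
    simp [hαβ, hβα, hf]

theorem Indecomposable.iso_M2 {M : LamRep K 1} (hM : M.Indecomposable)
    (hαβ : ∀ x, M.α (M.β x) = 0) (hβα : ∀ x, M.β (M.α x) = 0) {v : M.V2} (hv : M.β v ≠ 0) :
    M.Iso (M2 K le_rfl) := by
  obtain ⟨f, hf⟩ := exists_dual_apply_eq_one (K := K) hv
  refine hM.iso_of_retract 0 LinearMap.id _ _ (.inl inferInstance)
    (LinearMap.toSpanSingleton K _ (M.β v)) (LinearMap.toSpanSingleton K _ v)
    f (f ∘ₗ M.β) ?_ ?_ ?_ ?_ ?_ ?_ <;>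
    simp [hαβ, hβα, hf]

theorem Indecomposable.iso_S1 {M : LamRep K 1} (hM : M.Indecomposable)
    (hα : M.α = 0) (hβ : M.β = 0) {v : M.V1} (hv : v ≠ 0) : M.Iso (S1 K) := by
  obtain ⟨f, hf⟩ := exists_dual_apply_eq_one (K := K) hv
  refine hM.iso_of_retract (W2 := PUnit) 0 0 _ _ (.inl inferInstance)
    (LinearMap.toSpanSingleton K _ v) 0 f 0 ?_ ?_ ?_ ?_ ?_ ?_ <;>
    simp [hα, hβ, hf]

theorem Indecomposable.iso_S2 {M : LamRep K 1} (hM : M.Indecomposable)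
    (hα : M.α = 0) (hβ : M.β = 0) {v : M.V2} (hv : v ≠ 0) : M.Iso (S2 K) := by
  obtain ⟨f, hf⟩ := exists_dual_apply_eq_one (K := K) hv
  refine hM.iso_of_retract (W1 := PUnit) 0 0 _ _ (.inr inferInstance)
    0 (LinearMap.toSpanSingleton K _ v) 0 f ?_ ?_ ?_ ?_ ?_ ?_ <;>
    simp [hα, hβ, hf]

theorem Indecomposable.exists_iso {M : LamRep K 1} (hM : M.Indecomposable) :
    ∃ i : Fin 6, M.Iso (![S1 K, S2 K, M1 K le_rfl, M2 K le_rfl, Q1 K, Q2 K] i) := by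
  by_cases hβα : ∀ x, M.β (M.α x) = 0
  swap
  · push Not at hβα
    exact ⟨4, hM.iso_Q1 hβα.choose_spec⟩
  by_cases hαβ : ∀ x, M.α (M.β x) = 0
  swap
  · push Not at hαβ
    exact ⟨5, hM.iso_Q2 hαβ.choose_spec⟩
  by_cases hα : ∀ x, M.α x = 0
  swap
  · push Not at hα
    exact ⟨2, hM.iso_M1 hαβ hβα hα.choose_spec⟩
  by_cases hβ : ∀ x, M.β x = 0
  swap
  · push Not at hβ
    exact ⟨3, hM.iso_M2 hαβ hβα hβ.choose_spec⟩
  by_cases h1 : ∀ x : M.V1, x = 0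
  swap
  · push Not at h1
    exact ⟨0, hM.iso_S1 (LinearMap.ext hα) (LinearMap.ext hβ) h1.choose_spec⟩
  by_cases h2 : ∀ x : M.V2, x = 0
  swap
  · push Not at h2
    exact ⟨1, hM.iso_S2 (LinearMap.ext hα) (LinearMap.ext hβ) h2.choose_spec⟩
  exact absurd ⟨subsingleton_of_forall_eq 0 h1, subsingleton_of_forall_eq 0 h2⟩ hM.1

theorem Iso.α_eq_zero_iff {M N : LamRep K k} (h : M.Iso N) : M.α = 0 ↔ N.α = 0 := by
  obtain ⟨e1, e2, h, -⟩ := h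
  have h' x : e2 (M.α x) = N.α (e1 x) := LinearMap.congr_fun h x
  constructor <;> intro h0
  · ext y
    obtain ⟨x, rfl⟩ := e1.surjective y
    simp [← h', h0]
  · ext x
    exact e2.injective (by simp [h', h0])

theorem Iso.finrank_V1_eq {M N : LamRep K k} (h : M.Iso N) :
    Module.finrank K M.V1 = Module.finrank K N.V1 :=
  h.choose.finrank_eq

theorem Iso.finrank_V2_eq {M N : LamRep K k} (h : M.Iso N) :
    Module.finrank K M.V2 = Module.finrank K N.V2 :=
  h.choose_spec.choose.finrank_eq

theorem eq_of_iso_of_iso {M : LamRep K 1} {i j : Fin 6}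
    (hi : M.Iso (![S1 K, S2 K, M1 K le_rfl, M2 K le_rfl, Q1 K, Q2 K] i))
    (hj : M.Iso (![S1 K, S2 K, M1 K le_rfl, M2 K le_rfl, Q1 K, Q2 K] j)) : i = j := by
  have r0 : Module.finrank K PUnit.{1} = 0 := Module.finrank_zero_of_subsingleton
  have r1 : Module.finrank K K = 1 := Module.finrank_self K
  have r2 : Module.finrank K (K × K) = 2 := by simp
  have d1 (i : Fin 6) :
      Module.finrank K (![S1 K, S2 K, M1 K le_rfl, M2 K le_rfl, Q1 K, Q2 K] i : LamRep K 1).V1 =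
        ![1, 0, 1, 1, 2, 1] i := by
    fin_cases i
    exacts [r1, r0, r1, r1, r2, r1]
  have d2 (i : Fin 6) :
      Module.finrank K (![S1 K, S2 K, M1 K le_rfl, M2 K le_rfl, Q1 K, Q2 K] i : LamRep K 1).V2 =
        ![0, 1, 1, 1, 1, 2] i := by
    fin_cases i
    exacts [r0, r1, r1, r1, r1, r2]
  have e1 := hi.finrank_V1_eq.symm.trans hj.finrank_V1_eq
  have e2 := hi.finrank_V2_eq.symm.trans hj.finrank_V2_eq
  rw [d1, d1] at e1
  rw [d2, d2] at e2
  have hα := hi.α_eq_zero_iff.symm.trans hj.α_eq_zero_iff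
  have hM1 : (M1 K le_rfl : LamRep K 1).α ≠ 0 := fun h =>
    one_ne_zero (α := K) (LinearMap.congr_fun h (1 : K))
  have hM2 : (M2 K le_rfl : LamRep K 1).α = 0 := rfl
  fin_cases i <;> fin_cases j <;> first
    | rfl
    | exact absurd (hα.mpr hM2) hM1
    | exact absurd (hα.mp hM2) hM1
    | simp at e1 e2

end LamRep

/-- For `k = 1`, every nonzero indecomposable finite-dimensional `Λ_con`-module is
isomorphic to exactly one of the six representations
`S₁ = (K, 0, 0, 0)`, `S₂ = (0, K, 0, 0)`, `M₁ = (K, K, id, 0)`, `M₂ = (K, K, 0, id)`,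
`Q₁ = (K², K, α(s,t) = s, β(t) = (0,t))`, `Q₂ = (K, K², α(t) = (0,t), β(s,t) = s)`. -/
theorem lam_indecomposables_k_one (K : Type) [Field K] [IsAlgClosed K]
    (M : LamRep K 1) (hM : M.Indecomposable) :
    ∃! i : Fin 6,
      M.Iso (![LamRep.S1 K, LamRep.S2 K, LamRep.M1 K le_rfl, LamRep.M2 K le_rfl,
        LamRep.Q1 K, LamRep.Q2 K] i) := by
  obtain ⟨i, hi⟩ := hM.exists_iso
  exact ⟨i, hi, fun _ hj => LamRep.eq_of_iso_of_iso hj hi⟩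
end

section
/- Let K be an algebraically closed field and k ≥ 1. The contraction algebra Γ_con has finite representation type: there is a finite list of finite-dimensional Γ_con-modules such that every indecomposable finite-dimensional Γ_con-module is isomorphic to a member of the list. -/
/-- A finite-dimensional module over the contraction algebra `Γ_con` (the path algebra of
the quiver with two vertices, arrows `a : 1 → 2`, `b : 2 → 1` and a loop `y` at vertex `2`,
modulo `y^k = ba`, `ay = 0`, `yb = 0`), given concretely as a representation
`(V₁, V₂, α, β, η)` with `α ∘ β = η^k`, `η ∘ α = 0` and `β ∘ η = 0`. -/
structure GamRep (K : Type) [Field K] (k : ℕ) : Type 1 where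
  V1 : Type
  V2 : Type
  [acg1 : AddCommGroup V1]
  [acg2 : AddCommGroup V2]
  [mod1 : Module K V1]
  [mod2 : Module K V2]
  [fd1 : FiniteDimensional K V1]
  [fd2 : FiniteDimensional K V2]
  α : V1 →ₗ[K] V2
  β : V2 →ₗ[K] V1
  η : V2 →ₗ[K] V2
  rel1 : α ∘ₗ β = η ^ k
  rel2 : η ∘ₗ α = 0
  rel3 : β ∘ₗ η = 0

attribute [instance] GamRep.acg1 GamRep.acg2 GamRep.mod1 GamRep.mod2 GamRep.fd1 GamRep.fd2

namespace GamRep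

variable {K : Type} [Field K] {k : ℕ}

/-- A morphism of `Γ_con`-modules is a pair of linear maps commuting with the three
structure maps. -/
def IsHom (M N : GamRep K k) (φ1 : M.V1 →ₗ[K] N.V1) (φ2 : M.V2 →ₗ[K] N.V2) : Prop :=
  φ2 ∘ₗ M.α = N.α ∘ₗ φ1 ∧ φ1 ∘ₗ M.β = N.β ∘ₗ φ2 ∧ φ2 ∘ₗ M.η = N.η ∘ₗ φ2

/-- An isomorphism of `Γ_con`-modules is a pair of linear isomorphisms commuting with the
structure maps. -/
def Iso (M N : GamRep K k) : Prop :=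
  ∃ (φ1 : M.V1 ≃ₗ[K] N.V1) (φ2 : M.V2 ≃ₗ[K] N.V2),
    M.IsHom N (φ1 : M.V1 →ₗ[K] N.V1) (φ2 : M.V2 →ₗ[K] N.V2)

/-- The zero representation: both underlying vector spaces are trivial. -/
def IsZero (M : GamRep K k) : Prop := Subsingleton M.V1 ∧ Subsingleton M.V2

theorem prodMap_pow {V W : Type} [AddCommGroup V] [Module K V] [AddCommGroup W] [Module K W]
    (f : V →ₗ[K] V) (g : W →ₗ[K] W) (n : ℕ) :
    (f.prodMap g) ^ n = (f ^ n).prodMap (g ^ n) := by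
  induction n with
  | zero => ext <;> simp
  | succ n ih => rw [pow_succ, pow_succ, pow_succ, ih, LinearMap.prodMap_mul]

/-- The direct sum of two representations, taken componentwise. -/
def dsum (M N : GamRep K k) : GamRep K k where
  V1 := M.V1 × N.V1
  V2 := M.V2 × N.V2
  α := M.α.prodMap N.α
  β := M.β.prodMap N.β
  η := M.η.prodMap N.η
  rel1 := by
    rw [show (M.α.prodMap N.α) ∘ₗ (M.β.prodMap N.β) = (M.α ∘ₗ M.β).prodMap (N.α ∘ₗ N.β) from
      LinearMap.prodMap_comp _ _ _ _, M.rel1, N.rel1, prodMap_pow]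
  rel2 := by
    rw [show (M.η.prodMap N.η) ∘ₗ (M.α.prodMap N.α) = (M.η ∘ₗ M.α).prodMap (N.η ∘ₗ N.α) from
      LinearMap.prodMap_comp _ _ _ _, M.rel2, N.rel2, LinearMap.prodMap_zero]
  rel3 := by
    rw [show (M.β.prodMap N.β) ∘ₗ (M.η.prodMap N.η) = (M.β ∘ₗ M.η).prodMap (N.β ∘ₗ N.η) from
      LinearMap.prodMap_comp _ _ _ _, M.rel3, N.rel3, LinearMap.prodMap_zero]

/-- A representation is indecomposable if it is nonzero and not isomorphic to a direct sum
of two nonzero representations. -/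
def Indecomposable (M : GamRep K k) : Prop :=
  ¬ M.IsZero ∧ ∀ N P : GamRep K k, M.Iso (N.dsum P) → N.IsZero ∨ P.IsZero

/-- The endomorphism space of a representation, as a `K`-subspace of the product of the two
spaces of linear endomorphisms. -/
def endSpace (M : GamRep K k) :
    Submodule K ((M.V1 →ₗ[K] M.V1) × (M.V2 →ₗ[K] M.V2)) where
  carrier := {φ | M.IsHom M φ.1 φ.2}
  zero_mem' := by
    refine ⟨?_, ?_, ?_⟩ <;> simp [LinearMap.zero_comp, LinearMap.comp_zero]
  add_mem' := by
    rintro φ ψ ⟨h1, h2, h3⟩ ⟨h4, h5, h6⟩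
    refine ⟨?_, ?_, ?_⟩
    · simp only [Prod.fst_add, Prod.snd_add, LinearMap.add_comp, LinearMap.comp_add, h1, h4]
    · simp only [Prod.fst_add, Prod.snd_add, LinearMap.add_comp, LinearMap.comp_add, h2, h5]
    · simp only [Prod.fst_add, Prod.snd_add, LinearMap.add_comp, LinearMap.comp_add, h3, h6]
  smul_mem' := by
    rintro c φ ⟨h1, h2, h3⟩
    refine ⟨?_, ?_, ?_⟩
    · simp only [Prod.smul_fst, Prod.smul_snd, LinearMap.smul_comp, LinearMap.comp_smul, h1]
    · simp only [Prod.smul_fst, Prod.smul_snd, LinearMap.smul_comp, LinearMap.comp_smul, h2]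
    · simp only [Prod.smul_fst, Prod.smul_snd, LinearMap.smul_comp, LinearMap.comp_smul, h3]

variable (K)

/-- The simple module `S₁ = (K, 0)` with all structure maps zero (a representation whenever
`k ≥ 1`). -/
def S1 (hk : 1 ≤ k) : GamRep K k where
  V1 := K
  V2 := PUnit
  α := 0
  β := 0
  η := 0
  rel1 := by rw [LinearMap.zero_comp, zero_pow (Nat.one_le_iff_ne_zero.mp hk)]
  rel2 := by rw [LinearMap.comp_zero]
  rel3 := by rw [LinearMap.comp_zero]

/-- The simple module `S₂ = (0, K)` with all structure maps zero (a representation whenever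
`k ≥ 1`). -/
def S2 (hk : 1 ≤ k) : GamRep K k where
  V1 := PUnit
  V2 := K
  α := 0
  β := 0
  η := 0
  rel1 := by rw [LinearMap.zero_comp, zero_pow (Nat.one_le_iff_ne_zero.mp hk)]
  rel2 := by rw [LinearMap.comp_zero]
  rel3 := by rw [LinearMap.comp_zero]

/-- The module `M₁ = (K, K, α = id, β = 0, η = 0)` (a representation whenever `k ≥ 1`). -/
def M1 (hk : 1 ≤ k) : GamRep K k where
  V1 := K
  V2 := K
  α := LinearMap.id
  β := 0
  η := 0
  rel1 := by rw [LinearMap.comp_zero, zero_pow (Nat.one_le_iff_ne_zero.mp hk)]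
  rel2 := by rw [LinearMap.zero_comp]
  rel3 := by rw [LinearMap.comp_zero]

/-- The module `M₂ = (K, K, α = 0, β = id, η = 0)` (a representation whenever `k ≥ 1`). -/
def M2 (hk : 1 ≤ k) : GamRep K k where
  V1 := K
  V2 := K
  α := 0
  β := LinearMap.id
  η := 0
  rel1 := by rw [LinearMap.zero_comp, zero_pow (Nat.one_le_iff_ne_zero.mp hk)]
  rel2 := by rw [LinearMap.comp_zero]
  rel3 := by rw [LinearMap.comp_zero]

end GamRep

namespace GamRep

section Splitting

variable {K : Type} [Field K] {k : ℕ} {M N L : GamRep K k}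

theorem Iso.symm (h : M.Iso N) : N.Iso M := by
  obtain ⟨φ1, φ2, h1, h2, h3⟩ := h
  refine ⟨φ1.symm, φ2.symm, ?_, ?_, ?_⟩ <;> ext x
  · simpa [LinearEquiv.symm_apply_eq] using (LinearMap.congr_fun h1 (φ1.symm x)).symm
  · simpa [LinearEquiv.symm_apply_eq] using (LinearMap.congr_fun h2 (φ2.symm x)).symm
  · simpa [LinearEquiv.symm_apply_eq] using (LinearMap.congr_fun h3 (φ2.symm x)).symm

theorem IsHom.iso_of_bijective {φ1 : M.V1 →ₗ[K] N.V1} {φ2 : M.V2 →ₗ[K] N.V2}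
    (h : M.IsHom N φ1 φ2) (h1 : Function.Bijective φ1) (h2 : Function.Bijective φ2) :
    M.Iso N :=
  ⟨LinearEquiv.ofBijective φ1 h1, LinearEquiv.ofBijective φ2 h2, h⟩

/-- The kernel of a morphism of representations. -/
def ker (φ1 : M.V1 →ₗ[K] N.V1) (φ2 : M.V2 →ₗ[K] N.V2) (h : M.IsHom N φ1 φ2) :
    GamRep K k where
  V1 := LinearMap.ker φ1
  V2 := LinearMap.ker φ2
  α := M.α.restrict fun x hx => by
    have := LinearMap.congr_fun h.1 x
    simp_all
  β := M.β.restrict fun x hx => by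
    have := LinearMap.congr_fun h.2.1 x
    simp_all
  η := M.η.restrict fun x hx => by
    have := LinearMap.congr_fun h.2.2 x
    simp_all
  rel1 := by
    rw [Module.End.pow_restrict k]
    ext x
    exact LinearMap.congr_fun M.rel1 x
  rel2 := by
    ext x
    exact LinearMap.congr_fun M.rel2 x
  rel3 := by
    ext x
    exact LinearMap.congr_fun M.rel3 x

theorem bijective_coprod_ker_subtype {V W : Type} [AddCommGroup V] [Module K V]
    [AddCommGroup W] [Module K W] {i : W →ₗ[K] V} {p : V →ₗ[K] W}
    (h : Function.Bijective (p ∘ₗ i)) :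
    Function.Bijective (i.coprod (LinearMap.ker p).subtype) := by
  constructor
  · rw [injective_iff_map_eq_zero]
    rintro ⟨w, x, hx⟩ h0
    have hx' : p x = 0 := hx
    have h0' : i w + x = 0 := by simpa using h0
    have hw : w = 0 := h.1 (by simpa [hx'] using congrArg p h0')
    subst hw
    simpa using h0'
  · intro v
    obtain ⟨w, hw⟩ := h.2 (p v)
    have hw' : p (i w) = p v := hw
    exact ⟨(w, ⟨v - i w, by simp [hw']⟩), by simp⟩

/-- A nonzero direct summand of an indecomposable representation is isomorphic to it. -/
theorem Indecomposable.iso_of_split (hM : M.Indecomposable) (hL : ¬ L.IsZero)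
    {i1 : L.V1 →ₗ[K] M.V1} {i2 : L.V2 →ₗ[K] M.V2} (hi : L.IsHom M i1 i2)
    {p1 : M.V1 →ₗ[K] L.V1} {p2 : M.V2 →ₗ[K] L.V2} (hp : M.IsHom L p1 p2)
    (h1 : Function.Injective (p1 ∘ₗ i1)) (h2 : Function.Injective (p2 ∘ₗ i2)) :
    M.Iso L := by
  have b1 : Function.Bijective (p1 ∘ₗ i1) := ⟨h1, LinearMap.injective_iff_surjective.1 h1⟩
  have b2 : Function.Bijective (p2 ∘ₗ i2) := ⟨h2, LinearMap.injective_iff_surjective.1 h2⟩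
  have key : (L.dsum (ker p1 p2 hp)).Iso M := by
    refine IsHom.iso_of_bijective (M := L.dsum (ker p1 p2 hp))
      (φ1 := i1.coprod (LinearMap.ker p1).subtype) (φ2 := i2.coprod (LinearMap.ker p2).subtype)
      ⟨?_, ?_, ?_⟩ (bijective_coprod_ker_subtype b1) (bijective_coprod_ker_subtype b2)
    · refine LinearMap.ext fun x => ?_
      have := LinearMap.congr_fun hi.1 x.1
      simp only [LinearMap.comp_apply] at this
      change i2 (L.α x.1) + M.α x.2.1 = M.α (i1 x.1 + x.2.1)
      rw [map_add, this]
    · refine LinearMap.ext fun x => ?_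
      have := LinearMap.congr_fun hi.2.1 x.1
      simp only [LinearMap.comp_apply] at this
      change i1 (L.β x.1) + M.β x.2.1 = M.β (i2 x.1 + x.2.1)
      rw [map_add, this]
    · refine LinearMap.ext fun x => ?_
      have := LinearMap.congr_fun hi.2.2 x.1
      simp only [LinearMap.comp_apply] at this
      change i2 (L.η x.1) + M.η x.2.1 = M.η (i2 x.1 + x.2.1)
      rw [map_add, this]
  rcases hM.2 _ _ key.symm with h | ⟨z1, z2⟩
  · exact absurd h hL
  · have s1 : Function.Surjective p1 := Function.Surjective.of_comp b1.2
    have s2 : Function.Surjective p2 := Function.Surjective.of_comp b2.2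
    refine hp.iso_of_bijective ⟨?_, s1⟩ ⟨?_, s2⟩
    · exact LinearMap.ker_eq_bot.1 ((Submodule.subsingleton_iff_eq_bot).1 z1)
    · exact LinearMap.ker_eq_bot.1 ((Submodule.subsingleton_iff_eq_bot).1 z2)

end Splitting

section Block

variable (K : Type) [Field K]

/-- The nilpotent shift `e₀ ↦ e₁ ↦ ⋯ ↦ eₙ ↦ 0`. -/
def shift (n : ℕ) : (Fin (n + 1) → K) →ₗ[K] (Fin (n + 1) → K) :=
  LinearMap.pi (Fin.cons 0 fun j : Fin n => LinearMap.proj j.castSucc)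

variable {K}

@[simp] theorem shift_apply_zero {n : ℕ} (x : Fin (n + 1) → K) : shift K n x 0 = 0 := by
  simp [shift]

@[simp] theorem shift_apply_succ {n : ℕ} (x : Fin (n + 1) → K) (j : Fin n) :
    shift K n x j.succ = x j.castSucc := by
  simp [shift]

theorem shift_pow_apply {n : ℕ} (m : ℕ) (x : Fin (n + 1) → K) (j : Fin (n + 1)) :
    (shift K n ^ m) x j = if m ≤ j then x ⟨j - m, by omega⟩ else 0 := by
  induction m generalizing j with
  | zero => simp
  | succ m ih =>
    rw [pow_succ', Module.End.mul_apply]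
    cases j using Fin.cases with
    | zero => simp
    | succ j => simp [ih]

theorem shift_pow_self {n : ℕ} (x : Fin (n + 1) → K) :
    (shift K n ^ n) x = Pi.single (Fin.last n) (x 0) := by
  ext j
  rw [shift_pow_apply]
  by_cases hj : j = Fin.last n
  · subst hj
    simp
  · have : (j : ℕ) < n := Fin.val_lt_last hj
    rw [if_neg (by omega), Pi.single_eq_of_ne hj]

theorem shift_pow_eq_zero {n m : ℕ} (h : n < m) : shift K n ^ m = 0 := by
  ext x j
  simp only [LinearMap.comp_apply, shift_pow_apply]
  rw [if_neg (by omega)]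
  simp

variable {k : ℕ} {W : Type} [AddCommGroup W] [Module K W] [FiniteDimensional K W]

/-- The representation whose space at vertex `2` is a single Jordan block of size `n + 1`, with
`α` hitting its socle through `ρ : W → K` and `β` sending its top to `u : W`. -/
def block (n : ℕ) (ρ : W →ₗ[K] K) (u : W) (h : n < k ∧ ρ u = 0 ∨ n = k ∧ ρ u = 1) :
    GamRep K k where
  V1 := W
  V2 := Fin (n + 1) → K
  α := LinearMap.single K (fun _ => K) (Fin.last n) ∘ₗ ρ
  β := (LinearMap.proj 0).smulRight u
  η := shift K n
  rel1 := by
    refine LinearMap.ext fun x => ?_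
    rcases h with ⟨h, hu⟩ | ⟨rfl, hu⟩
    · simp [shift_pow_eq_zero h, hu]
    · rw [shift_pow_self]
      simp [hu]
  rel2 := by
    refine LinearMap.ext fun w => funext fun j => ?_
    cases j using Fin.cases with
    | zero => simp
    | succ j => simp [Fin.castSucc_ne_last]
  rel3 := by
    refine LinearMap.ext fun x => ?_
    simp

theorem block_not_isZero (n : ℕ) (ρ : W →ₗ[K] K) (u : W)
    (h : n < k ∧ ρ u = 0 ∨ n = k ∧ ρ u = 1) : ¬ (block n ρ u h).IsZero := by
  rintro ⟨-, h2⟩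
  exact not_subsingleton (Fin (n + 1) → K) h2

/-- The linear map `eⱼ ↦ ηʲ v`. -/
def orbitMap {V : Type} [AddCommGroup V] [Module K V] (η : V →ₗ[K] V) (v : V) (n : ℕ) :
    (Fin (n + 1) → K) →ₗ[K] V :=
  Fintype.linearCombination K fun j : Fin (n + 1) => (η ^ (j : ℕ)) v

/-- The linear map whose `j`-th coordinate is `f ∘ η ^ (n - j)`. -/
def coorbitMap {V : Type} [AddCommGroup V] [Module K V] (η : V →ₗ[K] V) (f : V →ₗ[K] K)
    (n : ℕ) : V →ₗ[K] (Fin (n + 1) → K) :=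
  LinearMap.pi fun j : Fin (n + 1) => f ∘ₗ η ^ (n - j : ℕ)

section Orbit

variable {V : Type} [AddCommGroup V] [Module K V] {η : V →ₗ[K] V} {n : ℕ}

theorem orbitMap_apply (v : V) (x : Fin (n + 1) → K) :
    orbitMap η v n x = ∑ j, x j • (η ^ (j : ℕ)) v := rfl

theorem coorbitMap_apply (f : V →ₗ[K] K) (x : V) (j : Fin (n + 1)) :
    coorbitMap η f n x j = f ((η ^ (n - j : ℕ)) x) := rfl

theorem orbitMap_shift (hη : η ^ (n + 1) = 0) (v : V) (x : Fin (n + 1) → K) :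
    orbitMap η v n (shift K n x) = η (orbitMap η v n x) := by
  rw [orbitMap_apply, orbitMap_apply, Fin.sum_univ_succ, Fin.sum_univ_castSucc]
  have : η ((η ^ n) v) = 0 := by
    rw [← Module.End.mul_apply, ← pow_succ', hη, LinearMap.zero_apply]
  simp [this, pow_succ']

theorem coorbitMap_map (hη : η ^ (n + 1) = 0) (f : V →ₗ[K] K) (x : V) :
    coorbitMap η f n (η x) = shift K n (coorbitMap η f n x) := by
  ext j
  cases j using Fin.cases with
  | zero =>
    rw [coorbitMap_apply, ← Module.End.mul_apply, ← pow_succ, shift_apply_zero]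
    simp [hη]
  | succ j =>
    rw [coorbitMap_apply, ← Module.End.mul_apply, ← pow_succ, shift_apply_succ,
      coorbitMap_apply]
    have : n - (j.succ : ℕ) + 1 = n - (j.castSucc : ℕ) := by
      simp only [Fin.val_succ, Fin.val_castSucc]
      omega
    rw [this]

theorem coorbitMap_comp_orbitMap_injective (hη : η ^ (n + 1) = 0) {v : V} {f : V →ₗ[K] K}
    (h : f ((η ^ n) v) ≠ 0) :
    Function.Injective (coorbitMap η f n ∘ₗ orbitMap η v n) := by
  rw [injective_iff_map_eq_zero]
  intro x hx
  have key : ∀ m (hm : m < n + 1), x ⟨m, hm⟩ = 0 := by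
    intro m
    induction m using Nat.strong_induction_on with
    | _ m ih =>
      intro hm
      have h0 := congrFun hx ⟨m, hm⟩
      rw [LinearMap.comp_apply, coorbitMap_apply, orbitMap_apply, map_sum, map_sum,
        Finset.sum_eq_single ⟨m, hm⟩] at h0
      · rw [map_smul, ← Module.End.mul_apply, ← pow_add, Nat.sub_add_cancel (by simp; omega)]
          at h0
        simpa [h] using h0
      · rintro ⟨j, hj⟩ - hne
        rcases lt_or_gt_of_ne (fun e => hne (Fin.ext e) : j ≠ m) with hlt | hgt
        · simp [ih j hlt]
        · rw [map_smul, ← Module.End.mul_apply, ← pow_add,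
            pow_eq_zero_of_le (by simp; omega) hη]
          simp
      · simp
  exact funext fun j => key j j.2

end Orbit

variable {M : GamRep K k}

/-- Criterion for an indecomposable representation to be isomorphic to a block. -/
theorem Indecomposable.iso_block (hM : M.Indecomposable) {n : ℕ} (hη : M.η ^ (n + 1) = 0)
    {ρ : W →ₗ[K] K} {u : W} (hρ : n < k ∧ ρ u = 0 ∨ n = k ∧ ρ u = 1)
    {v : M.V2} {f : M.V2 →ₗ[K] K} (hfv : f ((M.η ^ n) v) ≠ 0)
    {φ : W →ₗ[K] M.V1} {ψ : M.V1 →ₗ[K] W}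
    (hφu : φ u = M.β v) (hφα : ∀ w, M.α (φ w) = ρ w • (M.η ^ n) v)
    (hψβ : ∀ x, ψ (M.β x) = f ((M.η ^ n) x) • u) (hψα : ∀ x, ρ (ψ x) = f (M.α x))
    (hinj : Function.Injective (ψ ∘ₗ φ)) :
    M.Iso (block n ρ u hρ) := by
  have hηα : ∀ x, M.η (M.α x) = 0 := LinearMap.congr_fun M.rel2
  have hβη : ∀ x, M.β (M.η x) = 0 := LinearMap.congr_fun M.rel3
  refine hM.iso_of_split (L := block n ρ u hρ) (block_not_isZero n ρ u hρ)
    (i1 := φ) (i2 := orbitMap M.η v n) (p1 := ψ) (p2 := coorbitMap M.η f n)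
    ⟨?_, ?_, ?_⟩ ⟨?_, ?_, ?_⟩ hinj (coorbitMap_comp_orbitMap_injective hη hfv)
  · refine LinearMap.ext fun (w : W) => ?_
    change orbitMap M.η v n (Pi.single (Fin.last n) (ρ w)) = M.α (φ w)
    rw [hφα]
    simp [orbitMap]
  · refine LinearMap.ext fun (x : Fin (n + 1) → K) => ?_
    change φ (x 0 • u) = M.β (orbitMap M.η v n x)
    rw [orbitMap_apply, Fin.sum_univ_succ]
    simp [hφu, pow_succ', hβη]
  · exact LinearMap.ext fun x => orbitMap_shift hη v x
  · refine LinearMap.ext fun x => funext fun j => ?_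
    change coorbitMap M.η f n (M.α x) j = (Pi.single (Fin.last n) (ρ (ψ x)) : _ → K) j
    rw [coorbitMap_apply, hψα]
    by_cases hj : j = Fin.last n
    · subst hj
      simp
    · obtain ⟨m, hm⟩ := Nat.exists_eq_succ_of_ne_zero
        (Nat.sub_ne_zero_of_lt (Fin.val_lt_last hj))
      rw [hm, pow_succ, Module.End.mul_apply, hηα, Pi.single_eq_of_ne hj]
      simp
  · refine LinearMap.ext fun x => ?_
    change ψ (M.β x) = (coorbitMap M.η f n x) 0 • u
    rw [hψβ, coorbitMap_apply]
    simp
  · exact LinearMap.ext fun x => coorbitMap_map hη f x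

end Block

section Classification

variable (K : Type) [Field K] (k : ℕ)

/-- A finite list containing all indecomposable representations up to isomorphism: the
simple `S₁`, the projective cover
of `S₂`, and, for each `n < k`, the Jordan block of size `n + 1` with or without an extra basis
vector at vertex `1` mapping by `α` to its socle, and with or without one hit from its top by
`β`. -/
def indecList (hk : 1 ≤ k) : Option (Option (Fin k × Bool × Bool)) → GamRep K k
  | none => S1 K hk
  | some none => block (W := K) k LinearMap.id 1 (Or.inr ⟨rfl, rfl⟩)
  | some (some (n, false, false)) => block (W := PUnit) n 0 0 (Or.inl ⟨n.2, rfl⟩)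
  | some (some (n, true, false)) => block (W := K) n LinearMap.id 0 (Or.inl ⟨n.2, rfl⟩)
  | some (some (n, false, true)) => block (W := K) n 0 1 (Or.inl ⟨n.2, rfl⟩)
  | some (some (n, true, true)) =>
    block (W := K × K) n (LinearMap.fst K K K) (0, 1) (Or.inl ⟨n.2, rfl⟩)

variable {K k} {M : GamRep K k}

theorem Indecomposable.iso_S1 (hM : M.Indecomposable) (hk : 1 ≤ k) [Subsingleton M.V2] :
    M.Iso (S1 K hk) := by
  have hnt : Nontrivial M.V1 := by
    by_contra h
    exact hM.1 ⟨not_nontrivial_iff_subsingleton.1 h, ‹_›⟩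
  obtain ⟨w, hw⟩ := exists_ne (0 : M.V1)
  obtain ⟨g, hg, -⟩ := Submodule.exists_le_ker_of_notMem (p := (⊥ : Submodule K M.V1))
    (v := w) (by simpa using hw)
  have hL : ¬ (S1 K hk).IsZero := fun h => not_subsingleton K h.1
  have hV : ∀ x : M.V2, x = 0 := fun x => Subsingleton.elim _ _
  refine hM.iso_of_split hL (i1 := LinearMap.toSpanSingleton K M.V1 w) (i2 := 0)
    (p1 := g) (p2 := 0) ⟨?_, ?_, ?_⟩ ⟨?_, ?_, ?_⟩ ?_ (fun _ _ _ => rfl)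
  · exact LinearMap.ext fun x => Subsingleton.elim (α := M.V2) _ _
  · refine LinearMap.ext fun x => ?_
    change (0 : K) • w = M.β 0
    simp
  · exact LinearMap.ext fun x => Subsingleton.elim (α := M.V2) _ _
  · exact LinearMap.ext fun x => rfl
  · refine LinearMap.ext fun x => ?_
    simp [hV x]
  · exact LinearMap.ext fun x => rfl
  · rw [injective_iff_map_eq_zero]
    intro (c : K) hc
    have hc' : g (c • w) = 0 := hc
    rw [map_smul, smul_eq_mul] at hc'
    exact (mul_eq_zero.1 hc').resolve_right hg

theorem exists_comp_eq_of_ker_le {V V' : Type} [AddCommGroup V] [Module K V]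
    [AddCommGroup V'] [Module K V'] (β : V →ₗ[K] V') (h : V →ₗ[K] K)
    (hβ : ∀ x, β x = 0 → h x = 0) : ∃ g : V' →ₗ[K] K, ∀ x, g (β x) = h x := by
  have hmem : h ∈ LinearMap.range β.dualMap := by
    rw [LinearMap.range_dualMap_eq_dualAnnihilator_ker, Submodule.mem_dualAnnihilator]
    exact hβ
  obtain ⟨g, hg⟩ := hmem
  exact ⟨g, LinearMap.congr_fun hg⟩

/-- An indecomposable representation on which `η ^ k` does not vanish is projective. -/
theorem Indecomposable.iso_projective (hM : M.Indecomposable) (hη : M.η ^ (k + 1) = 0)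
    {v : M.V2} (hv : (M.η ^ k) v ≠ 0) :
    M.Iso (block (W := K) k LinearMap.id 1 (Or.inr ⟨rfl, rfl⟩)) := by
  have hαβ : ∀ x, M.α (M.β x) = (M.η ^ k) x := LinearMap.congr_fun M.rel1
  obtain ⟨f, hf, -⟩ := Submodule.exists_le_ker_of_notMem (p := (⊥ : Submodule K M.V2))
    (v := (M.η ^ k) v) (by simpa using hv)
  refine hM.iso_block hη _ (v := v) (f := f) hf
    (φ := LinearMap.toSpanSingleton K M.V1 (M.β v)) (ψ := f ∘ₗ M.α) ?_ ?_ ?_ ?_ ?_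
  · simp
  · simp [hαβ]
  · simp [hαβ]
  · simp
  · rw [injective_iff_map_eq_zero]
    intro c hc
    simpa [hαβ, hf] using hc

/-- An indecomposable representation with `η` of nilpotency index `n + 1 ≤ k` is a Jordan block
of size `n + 1` decorated at its two ends. -/
theorem Indecomposable.iso_nonprojective (hM : M.Indecomposable) {hk : 1 ≤ k} {n : ℕ}
    (hn : n < k) (hη : M.η ^ (n + 1) = 0) (hη' : M.η ^ n ≠ 0) :
    ∃ a b : Bool, M.Iso (indecList K k hk (some (some (⟨n, hn⟩, a, b)))) := by
  have hk0 : M.η ^ k = 0 := pow_eq_zero_of_le hn hη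
  have hαβ : ∀ x, M.α (M.β x) = 0 := fun x => by
    simpa [hk0] using LinearMap.congr_fun M.rel1 x
  have sep : ∀ {p : Submodule K M.V2} {x : M.V2}, x ∉ p →
      ∃ f : M.V2 →ₗ[K] K, f x ≠ 0 ∧ ∀ y ∈ p, f y = 0 :=
    fun hx => Submodule.exists_le_ker_of_notMem hx
  by_cases c1 : ∃ v, M.β v = 0 ∧ (M.η ^ n) v ∉ LinearMap.range M.α
  · obtain ⟨v, hβv, hv⟩ := c1
    obtain ⟨f, hf, hfα⟩ := sep hv
    refine ⟨false, false, hM.iso_block (W := PUnit) (ρ := 0) (u := 0) hη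
      (Or.inl ⟨hn, rfl⟩) (v := v) (f := f) hf (φ := 0) (ψ := 0)
      ?_ ?_ ?_ ?_ (fun _ _ _ => rfl)⟩
    · simp [hβv]
    · simp
    · simp
    · simp [hfα]
  by_cases c2 : ∃ v, M.β v = 0 ∧ (M.η ^ n) v ≠ 0
  · obtain ⟨v, hβv, hv⟩ := c2
    obtain ⟨w, hw⟩ : (M.η ^ n) v ∈ LinearMap.range M.α := by
      by_contra h
      exact c1 ⟨v, hβv, h⟩
    obtain ⟨f, hf, -⟩ := sep (p := ⊥) (by simpa using hv)
    refine ⟨true, false, hM.iso_block (W := K) (ρ := LinearMap.id) (u := 0) hη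
      (Or.inl ⟨hn, rfl⟩) (v := v) (f := f) hf
      (φ := LinearMap.toSpanSingleton K M.V1 w) (ψ := f ∘ₗ M.α) ?_ ?_ ?_ ?_ ?_⟩
    · simp [hβv]
    · simp [hw]
    · simp [hαβ]
    · simp
    · rw [injective_iff_map_eq_zero]
      intro c hc
      simpa [hw, hf] using hc
  have hker : ∀ x, M.β x = 0 → (M.η ^ n) x = 0 := fun x hx => by
    by_contra h
    exact c2 ⟨x, hx, h⟩
  have hfactor : ∀ f : M.V2 →ₗ[K] K, ∃ g : M.V1 →ₗ[K] K,
      ∀ x, g (M.β x) = f ((M.η ^ n) x) := fun f =>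
    exists_comp_eq_of_ker_le M.β (f ∘ₗ M.η ^ n) fun x hx => by simp [hker x hx]
  by_cases c3 : ∃ v w, M.α w = (M.η ^ n) v ∧ (M.η ^ n) v ≠ 0
  · obtain ⟨v, w, hw, hv⟩ := c3
    obtain ⟨f, hf, -⟩ := sep (p := ⊥) (by simpa using hv)
    obtain ⟨g, hg⟩ := hfactor f
    refine ⟨true, true, hM.iso_block (W := K × K) (ρ := LinearMap.fst K K K) (u := (0, 1)) hη
      (Or.inl ⟨hn, rfl⟩) (v := v) (f := f) hf
      (φ := (LinearMap.toSpanSingleton K M.V1 w).coprod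
        (LinearMap.toSpanSingleton K M.V1 (M.β v)))
      (ψ := (f ∘ₗ M.α).prod g) ?_ ?_ ?_ ?_ ?_⟩
    · simp
    · simp [hw, hαβ]
    · simp [hαβ, hg]
    · simp
    · rw [injective_iff_map_eq_zero]
      rintro ⟨c, d⟩ hc
      obtain ⟨h1, h2⟩ : c = 0 ∧ c * g w + d * f ((M.η ^ n) v) = 0 := by
        simpa [hw, hαβ, hg, hf] using hc
      subst h1
      simpa [hf] using h2
  · obtain ⟨v, hv⟩ : ∃ v, (M.η ^ n) v ≠ 0 := by
      by_contra! h
      exact hη' (LinearMap.ext h)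
    obtain ⟨f, hf, hfα⟩ := sep (p := LinearMap.range M.α) (x := (M.η ^ n) v)
      fun ⟨w, hw⟩ => c3 ⟨v, w, hw, hv⟩
    obtain ⟨g, hg⟩ := hfactor f
    refine ⟨false, true, hM.iso_block (W := K) (ρ := 0) (u := 1) hη
      (Or.inl ⟨hn, rfl⟩) (v := v) (f := f) hf
      (φ := LinearMap.toSpanSingleton K M.V1 (M.β v)) (ψ := g) ?_ ?_ ?_ ?_ ?_⟩
    · simp
    · simp [hαβ]
    · simp [hg]
    · simp [hfα]
    · rw [injective_iff_map_eq_zero]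
      intro c hc
      simpa [hg, hf] using hc

theorem η_pow_succ (M : GamRep K k) : M.η ^ (k + 1) = 0 := by
  rw [pow_succ', ← M.rel1, Module.End.mul_eq_comp, ← LinearMap.comp_assoc, M.rel2,
    LinearMap.zero_comp]

theorem Indecomposable.exists_iso_indecList (hM : M.Indecomposable) (hk : 1 ≤ k) :
    ∃ i, M.Iso (indecList K k hk i) := by
  rcases subsingleton_or_nontrivial M.V2 with h | h
  · exact ⟨none, hM.iso_S1 hk⟩
  classical
  have hex : ∃ n, M.η ^ (n + 1) = 0 := ⟨k, M.η_pow_succ⟩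
  obtain ⟨n, hη, hmin⟩ : ∃ n, M.η ^ (n + 1) = 0 ∧ ∀ m < n, M.η ^ (m + 1) ≠ 0 :=
    ⟨Nat.find hex, Nat.find_spec hex, fun m hm => Nat.find_min hex hm⟩
  have hη' : M.η ^ n ≠ 0 := by
    cases n with
    | zero => simp
    | succ m => exact hmin m m.lt_succ_self
  have hnk : n ≤ k := by
    by_contra! hlt
    exact hmin k hlt M.η_pow_succ
  rcases hnk.lt_or_eq with hlt | rfl
  · obtain ⟨a, b, hab⟩ := hM.iso_nonprojective (hk := hk) hlt hη hη'
    exact ⟨_, hab⟩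
  · obtain ⟨v, hv⟩ : ∃ v, (M.η ^ n) v ≠ 0 := by
      by_contra! h0
      exact hη' (LinearMap.ext h0)
    exact ⟨some none, hM.iso_projective hη hv⟩

end Classification

end GamRep

/-- The contraction algebra `Γ_con` has finite representation type: there is a finite list
of finite-dimensional `Γ_con`-modules such that every indecomposable finite-dimensional
`Γ_con`-module is isomorphic to a member of the list. -/
theorem gam_finite_representation_type (K : Type) [Field K] [IsAlgClosed K]
    (k : ℕ) (hk : 1 ≤ k) :
    ∃ (n : ℕ) (L : Fin n → GamRep K k),
      ∀ M : GamRep K k, M.Indecomposable → ∃ i, M.Iso (L i) := by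
  obtain ⟨n, ⟨e⟩⟩ := Finite.exists_equiv_fin (Option (Option (Fin k × Bool × Bool)))
  refine ⟨n, fun i => GamRep.indecList K k hk (e.symm i), fun M hM => ?_⟩
  obtain ⟨i, hi⟩ := hM.exists_iso_indecList hk
  exact ⟨e i, by simpa using hi⟩
end

section
/- Let G be the free product of a family of groups (G_i)_{i ∈ ι} in which one factor is isomorphic to ℤ and every other factor is a finite group. Then G contains no subgroup isomorphic to ℤ × ℤ: there is no injective group homomorphism ℤ × ℤ → G. -/
namespace Monoid.CoprodI

variable {ι : Type*} {G : ι → Type*} [∀ i, Group (G i)]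

/-- The product in the free product of a (not necessarily reduced) list of letters. -/
def letterProd (l : List (Σ i, G i)) : CoprodI G :=
  (l.map fun x => of x.2).prod

@[simp]
theorem letterProd_nil : letterProd ([] : List (Σ i, G i)) = 1 := rfl

@[simp]
theorem letterProd_cons (x : Σ i, G i) (l : List (Σ i, G i)) :
    letterProd (x :: l) = of x.2 * letterProd l := by
  simp [letterProd]

@[simp]
theorem letterProd_append (l₁ l₂ : List (Σ i, G i)) :
    letterProd (l₁ ++ l₂) = letterProd l₁ * letterProd l₂ := by
  simp [letterProd]

open Classical in
/-- The list of letters of the reduced word representing an element of the free product. -/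
noncomputable def normalForm (g : CoprodI G) : List (Σ i, G i) :=
  (Word.equiv g).toList

@[simp]
theorem letterProd_normalForm (g : CoprodI G) : letterProd (normalForm g) = g := by
  classical
  exact Word.equiv.symm_apply_apply g

theorem normalForm_injective : Function.Injective (normalForm (G := G)) :=
  Function.LeftInverse.injective letterProd_normalForm

theorem normalForm_ne_one {g : CoprodI G} {x : Σ i, G i} (hx : x ∈ normalForm g) : x.2 ≠ 1 := by
  classical
  exact (Word.equiv g).ne_one x hx

theorem isChain_normalForm (g : CoprodI G) :
    (normalForm g).IsChain fun x y => x.1 ≠ y.1 := by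
  classical
  exact (Word.equiv g).chain_ne

theorem normalForm_letterProd {l : List (Σ i, G i)} (h1 : ∀ x ∈ l, x.2 ≠ 1)
    (hl : l.IsChain fun x y => x.1 ≠ y.1) : normalForm (letterProd l) = l := by
  classical
  exact congrArg Word.toList (Word.equiv.apply_symm_apply (⟨l, h1, hl⟩ : Word G))

@[simp]
theorem normalForm_one : normalForm (1 : CoprodI G) = [] :=
  normalForm_letterProd (l := []) (by simp) (by simp)

theorem normalForm_of {i : ι} {x : G i} (hx : x ≠ 1) :
    normalForm (of x : CoprodI G) = [⟨i, x⟩] := by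
  simpa using normalForm_letterProd (l := [(⟨i, x⟩ : Σ i, G i)]) (by simpa) (by simp)

theorem Word.length_of_smul_le [DecidableEq ι] [∀ i, DecidableEq (G i)] {i : ι} (x : G i)
    (w : Word G) : (of x • w).toList.length ≤ w.toList.length + 1 := by
  have le_rcons (p : Word.Pair G i) : p.tail.toList.length ≤ (Word.rcons p).toList.length := by
    unfold Word.rcons
    split_ifs <;> simp
  have rcons_le (p : Word.Pair G i) :
      (Word.rcons p).toList.length ≤ p.tail.toList.length + 1 := by
    unfold Word.rcons
    split_ifs <;> simp
  have h := le_rcons (Word.equivPair i w)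
  rw [← Word.equivPair_symm, Equiv.symm_apply_apply] at h
  rw [Word.of_smul_def]
  exact (rcons_le _).trans (Nat.add_le_add_right h 1)

theorem length_normalForm_letterProd_le (l : List (Σ i, G i)) :
    (normalForm (letterProd l)).length ≤ l.length := by
  classical
  induction l with
  | nil => simp
  | cons x l ih =>
    have h := Word.length_of_smul_le x.2 (Word.equiv (letterProd l))
    have e : of x.2 • Word.equiv (letterProd l) = Word.equiv (letterProd (x :: l)) := by
      rw [letterProd_cons]
      exact (mul_smul _ _ _).symm
    rw [e] at h
    exact h.trans (Nat.add_le_add_right ih 1)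

/-- No reduction takes place between the normal forms of `g` and `h`: the last letter of the
first and the first letter of the second belong to different factors. -/
def Reduced (g h : CoprodI G) : Prop :=
  ∀ x ∈ (normalForm g).getLast?, ∀ y ∈ (normalForm h).head?, x.1 ≠ y.1

theorem Reduced.normalForm_mul {g h : CoprodI G} (H : Reduced g h) :
    normalForm (g * h) = normalForm g ++ normalForm h := by
  have key := normalForm_letterProd (l := normalForm g ++ normalForm h)
    (fun x hx => (List.mem_append.1 hx).elim normalForm_ne_one normalForm_ne_one)
    (List.isChain_append.2 ⟨isChain_normalForm g, isChain_normalForm h, H⟩)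
  simpa using key

theorem reduced_of_length_le {g h : CoprodI G}
    (H : (normalForm g).length + (normalForm h).length ≤ (normalForm (g * h)).length) :
    Reduced g h := by
  rintro ⟨i, x⟩ hx ⟨j, y⟩ hy (rfl : i = j)
  obtain ⟨u, hu⟩ := List.getLast?_eq_some_iff.1 hx
  obtain ⟨v, hv⟩ := List.head?_eq_some_iff.1 hy
  have e : letterProd (u ++ ⟨i, x * y⟩ :: v) = g * h := by
    rw [← letterProd_normalForm g, ← letterProd_normalForm h, hu, hv]
    simp [mul_assoc]
  have hle := length_normalForm_letterProd_le (u ++ ⟨i, x * y⟩ :: v)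
  rw [e] at hle
  simp only [hu, hv, List.length_append, List.length_cons, List.length_nil] at H hle
  omega

theorem normalForm_inv (g : CoprodI G) :
    normalForm g⁻¹ = ((normalForm g).map fun x => (⟨x.1, x.2⁻¹⟩ : Σ i, G i)).reverse := by
  have e (l : List (Σ i, G i)) :
      letterProd (l.map fun x => (⟨x.1, x.2⁻¹⟩ : Σ i, G i)).reverse = (letterProd l)⁻¹ := by
    induction l with
    | nil => simp
    | cons x l ih => simp [ih]
  have key := normalForm_letterProd
    (l := ((normalForm g).map fun x => (⟨x.1, x.2⁻¹⟩ : Σ i, G i)).reverse) ?_ ?_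
  · rwa [e, letterProd_normalForm] at key
  · intro x hx
    obtain ⟨y, hy, rfl⟩ := List.mem_map.1 (List.mem_reverse.1 hx)
    exact inv_ne_one.2 (normalForm_ne_one hy)
  · rw [List.isChain_reverse, List.isChain_map]
    exact (isChain_normalForm g).imp fun _ _ h => h.symm

theorem normalForm_mul_of_commute {b w : CoprodI G} (hbw : Commute b w) (H : Reduced b w) :
    normalForm b ++ normalForm w = normalForm w ++ normalForm b := by
  rw [← H.normalForm_mul, hbw.eq]
  refine (reduced_of_length_le ?_).normalForm_mul
  rw [← hbw.eq, H.normalForm_mul, List.length_append, add_comm]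

theorem normalForm_prefix_of_commute {b w : CoprodI G} (hw : w ≠ 1) (hbw : Commute b w)
    (H : Reduced b w) (hmin : (normalForm b).length ≤ (normalForm (w⁻¹ * b)).length) :
    normalForm b <+: normalForm w := by
  rcases List.append_eq_append_iff.1 (normalForm_mul_of_commute hbw H) with
    ⟨l, hl, -⟩ | ⟨l, hl, -⟩
  · exact ⟨l, hl.symm⟩
  · have e : w⁻¹ * b = letterProd l := by
      rw [← letterProd_normalForm b, hl]
      simp
    have hw' : normalForm w ≠ [] := fun h => hw (normalForm_injective (h.trans normalForm_one.symm))
    have := List.length_pos_iff.2 hw'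
    have hle := length_normalForm_letterProd_le l
    rw [e, hl, List.length_append] at hmin
    omega

/-- The centralizer of a cyclically reduced element is virtually generated by that element. -/
theorem exists_pow_mem_zpowers_of_reduced {b w : CoprodI G} (hw : w ≠ 1) (hred : Reduced w w)
    (hbw : Commute b w) : ∃ m : ℤ, m ≠ 0 ∧ b ^ m ∈ Subgroup.zpowers w := by
  let S : Set (CoprodI G) :=
    {g | normalForm g <+: normalForm w ∨ normalForm g <+: normalForm w⁻¹}
  have hS : S.Finite := by
    refine Set.Finite.preimage normalForm_injective.injOn
      (s := {l | l <+: normalForm w ∨ l <+: normalForm w⁻¹}) ?_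
    refine ((normalForm w).inits ++ (normalForm w⁻¹).inits).finite_toSet.subset ?_
    intro l hl
    simpa using hl
  have key (n : ℤ) : ∃ k : ℤ, b ^ n * w ^ k ∈ S := by
    let f : ℤ → ℕ := fun k => (normalForm (b ^ n * w ^ k)).length
    let k := Function.argmin f
    have hc : Commute (b ^ n * w ^ k) w :=
      (hbw.zpow_left n).mul_left ((Commute.refl w).zpow_left k)
    refine ⟨k, ?_⟩
    by_cases H : Reduced (b ^ n * w ^ k) w
    · refine .inl (normalForm_prefix_of_commute hw hc H ?_)
      rw [← hc.inv_right.eq, mul_assoc, ← zpow_sub_one]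
      exact Function.argmin_le f (k - 1)
    · refine .inr (normalForm_prefix_of_commute (inv_ne_one.2 hw) hc.inv_right ?_ ?_)
      · unfold Reduced at H
        push Not at H
        obtain ⟨x, hx, y, hy, hxy⟩ := H
        intro x' hx' z hz
        rw [normalForm_inv, List.head?_reverse, List.getLast?_map] at hz
        obtain ⟨t, ht, rfl⟩ := Option.mem_map.1 hz
        obtain rfl := Option.mem_unique hx hx'
        rw [hxy]
        exact (hred t ht y hy).symm
      · rw [inv_inv, ← hc.eq, mul_assoc, ← zpow_add_one]
        exact Function.argmin_le f (k + 1)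
  choose k hk using key
  have := hS.to_subtype
  obtain ⟨m, n, hmn, e⟩ := Finite.exists_ne_map_eq_of_infinite fun n => (⟨_, hk n⟩ : S)
  refine ⟨m - n, sub_ne_zero.2 hmn, k n - k m, ?_⟩
  have e' : b ^ m * w ^ k m = b ^ n * w ^ k n := congrArg Subtype.val e
  have hb : b ^ m = b ^ n * w ^ k n * (w ^ k m)⁻¹ := eq_mul_inv_of_mul_eq e'
  have hc : Commute (b ^ n) (w ^ (k n - k m)) := (hbw.zpow_left n).zpow_right _
  change w ^ (k n - k m) = b ^ (m - n)
  rw [zpow_sub b, hb, mul_assoc (b ^ n), ← zpow_sub w, hc.eq, mul_inv_cancel_right]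

/-- An element commuting with a nontrivial element of a commutative factor lies in that factor. -/
theorem mem_range_of_of_commute {i : ι} (hi : ∀ x y : G i, Commute x y) {x : G i} (hx : x ≠ 1)
    {b : CoprodI G} (hb : Commute b (of x)) : b ∈ (of : G i →* CoprodI G).range := by
  let f : G i → ℕ := fun y => (normalForm (b * of y)).length
  let y := Function.argmin f
  have hmin (z : G i) : f y ≤ f z := Function.argmin_le f z
  have hc : Commute (b * of y) (of x) := hb.mul_left ((hi y x).map of)
  have hlast : ∀ t ∈ (normalForm (b * of y)).getLast?, t.1 ≠ i := by
    rintro ⟨j, t⟩ ht (rfl : j = i)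
    obtain ⟨u, hu⟩ := List.getLast?_eq_some_iff.1 ht
    have e : b * of (y * t⁻¹) = letterProd u := by
      rw [map_mul, ← mul_assoc, ← letterProd_normalForm (b * of y), hu]
      simp
    have h := (hmin (y * t⁻¹)).trans_eq (congrArg (fun g => (normalForm g).length) e)
    have hle := h.trans (length_normalForm_letterProd_le u)
    simp [f, hu] at hle
  have hnf := normalForm_of hx
  have hred : Reduced (b * of y) (of x) := by
    intro t ht s hs
    rw [hnf] at hs
    obtain rfl : (⟨i, x⟩ : Σ i, G i) = s := by simpa using hs
    exact hlast t ht
  have h := normalForm_mul_of_commute hc hred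
  rw [hnf] at h
  have hnil : normalForm (b * of y) = [] := by
    by_contra hne
    have hl := congrArg List.getLast? h
    rw [List.getLast?_concat, List.getLast?_append_of_ne_nil _ hne] at hl
    exact hlast ⟨i, x⟩ hl.symm rfl
  have h1 : b * of y = 1 := normalForm_injective (hnil.trans normalForm_one.symm)
  exact ⟨y⁻¹, by rw [map_inv, eq_inv_of_mul_eq_one_left h1]⟩

/-- An element of minimal length in its conjugacy class is cyclically reduced or lies in a
factor. -/
theorem reduced_self_or_eq_of {w : CoprodI G}
    (hmin : ∀ c : CoprodI G, (normalForm w).length ≤ (normalForm (c * w * c⁻¹)).length) :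
    Reduced w w ∨ ∃ (i : ι) (x : G i), w = of x := by
  refine or_iff_not_imp_left.2 fun H => ?_
  unfold Reduced at H
  push Not at H
  obtain ⟨⟨i, x⟩, hx, ⟨j, y⟩, hy, (rfl : i = j)⟩ := H
  obtain ⟨u, hu⟩ := List.getLast?_eq_some_iff.1 hx
  refine ⟨i, x, ?_⟩
  cases u with
  | nil => rw [← letterProd_normalForm w, hu]; simp
  | cons z u =>
    rw [hu] at hy
    obtain rfl : z = ⟨i, y⟩ := by simpa using hy
    have e : (of y)⁻¹ * w * (of y)⁻¹⁻¹ = letterProd (u ++ [⟨i, x * y⟩]) := by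
      rw [← letterProd_normalForm w, hu]
      simp [mul_assoc]
    have hle := hmin (of y)⁻¹
    rw [e] at hle
    replace hle := hle.trans (length_normalForm_letterProd_le _)
    simp [hu] at hle

/-- In a free product of an infinite cyclic group and finite groups, centralizers of elements of
infinite order are virtually cyclic. -/
theorem exists_pow_mem_zpowers_of_commute {i₀ : ι} (e : G i₀ ≃* Multiplicative ℤ)
    (hfin : ∀ i, i ≠ i₀ → Finite (G i)) {a b : CoprodI G} (ha : ¬ IsOfFinOrder a)
    (hab : Commute b a) : ∃ m : ℤ, m ≠ 0 ∧ b ^ m ∈ Subgroup.zpowers a := by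
  let f : CoprodI G → ℕ := fun c => (normalForm (MulAut.conj c a)).length
  let c := Function.argmin f
  suffices h : ∃ m : ℤ, m ≠ 0 ∧ (MulAut.conj c b) ^ m ∈ Subgroup.zpowers (MulAut.conj c a) by
    obtain ⟨m, hm, k, hk⟩ := h
    refine ⟨m, hm, k, (MulAut.conj c).injective ?_⟩
    simpa using hk
  have hc : Commute (MulAut.conj c b) (MulAut.conj c a) := hab.map (MulAut.conj c)
  have hw : ¬ IsOfFinOrder (MulAut.conj c a) := by
    rwa [← MulEquiv.coe_toMonoidHom, (MulAut.conj c).injective.isOfFinOrder_iff]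
  have hmin (d : CoprodI G) : (normalForm (MulAut.conj c a)).length ≤
      (normalForm (d * MulAut.conj c a * d⁻¹)).length := by
    have h : f c ≤ f (d * c) := Function.argmin_le f (d * c)
    have e : MulAut.conj (d * c) a = d * MulAut.conj c a * d⁻¹ := by simp [mul_assoc]
    rwa [← e]
  generalize MulAut.conj c a = w at *
  generalize MulAut.conj c b = b' at *
  have hw1 : w ≠ 1 := by rintro rfl; exact hw .one
  rcases reduced_self_or_eq_of hmin with hred | ⟨i, x, rfl⟩
  · exact exists_pow_mem_zpowers_of_reduced hw1 hred hc
  · obtain rfl : i = i₀ := by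
      by_contra hi
      have := hfin i hi
      exact hw (of.isOfFinOrder (isOfFinOrder_of_finite x))
    have hx : x ≠ 1 := by rintro rfl; exact hw1 (map_one _)
    obtain ⟨y, rfl⟩ := mem_range_of_of_commute
      (fun s t => e.injective (by rw [map_mul, map_mul, mul_comm])) hx hc
    refine ⟨(e x).toAdd, fun h => hx (e.injective ?_), (e y).toAdd, ?_⟩
    · rw [map_one]; exact h
    · change of x ^ _ = of y ^ _
      rw [← map_zpow, ← map_zpow]
      congr 1
      apply e.injective
      apply Multiplicative.toAdd.injective
      simp [mul_comm]

end Monoid.CoprodI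


/-- A free product of a family of groups in which one factor is isomorphic to `ℤ` and every
other factor is finite contains no subgroup isomorphic to `ℤ × ℤ`: there is no injective
group homomorphism `ℤ × ℤ → G`.  (This is the consequence of Kurosh's subgroup theorem used
to rule out incompressible tori.) -/
theorem coprodI_int_finite_no_Z2_subgroup (ι : Type*) (G : ι → Type*) [∀ i, Group (G i)]
    (i₀ : ι) (h₀ : Nonempty (G i₀ ≃* Multiplicative ℤ))
    (hfin : ∀ i, i ≠ i₀ → Finite (G i)) :
    ¬ ∃ f : Multiplicative (ℤ × ℤ) →* Monoid.CoprodI G, Function.Injective f := by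
  rintro ⟨f, hf⟩
  obtain ⟨e⟩ := h₀
  have ha : ¬ IsOfFinOrder (f (.ofAdd (1, 0))) := by
    rw [hf.isOfFinOrder_iff, isOfFinOrder_iff_pow_eq_one]
    rintro ⟨n, hn, h⟩
    have := congrArg (fun z => (Multiplicative.toAdd z).1) h
    simp at this
    omega
  obtain ⟨m, hm, k, hk⟩ := Monoid.CoprodI.exists_pow_mem_zpowers_of_commute e hfin ha
    ((Commute.all (.ofAdd ((0, 1) : ℤ × ℤ)) (.ofAdd (1, 0))).map f)
  change f _ ^ k = f _ ^ m at hk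
  rw [← map_zpow f, ← map_zpow f] at hk
  have := congrArg (fun z => (Multiplicative.toAdd z).2) (hf hk)
  simp at this
  exact hm this.symm
end
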